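/- arXiv:2001.06321 — 2 statements merged into one kernel-verified Lean document; each statement's English description precedes it below -/
import Mathlib

section
/- If α and β are primary, non-unit, relatively prime Gaussian integers, then (β/α)₄ = −(α/β)₄ when both α ≡ 3+2i (mod 4) and β ≡ 3+2i (mod 4), and (β/α)₄ = (α/β)₄ otherwise. -/
open Zsqrtd

local notation "ℤ[i]" => GaussianInt

/-- The imaginary unit `i` in `ℤ[i]`. -/
def gi : ℤ[i] := Zsqrtd.sqrtd

/-- `α` is primary if `α ≡ 1 (mod 2(1+i))`. -/
def IsPrimary (α : ℤ[i]) : Prop := 2 * (1 + gi) ∣ α - 1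
open scoped Classical in
/-- The quartic residue symbol `(α/π)₄`: the unique power of `i` congruent to
`α ^ ((Nπ - 1)/4)` modulo `π`, where `Nπ` is the cardinality of `ℤ[i]/(π)`. -/
noncomputable def quartic (α π : ℤ[i]) : ℤ[i] :=
  if h : ∃ k : Fin 4,
      π ∣ α ^ ((Nat.card (ℤ[i] ⧸ Ideal.span {π}) - 1) / 4) - gi ^ (k : ℕ)
  then gi ^ ((h.choose : Fin 4) : ℕ) else 0

/-- The quartic residue symbol with composite denominator, extended
multiplicatively over the prime factors of the denominator. -/
noncomputable def quarticGen (α β : ℤ[i]) : ℤ[i] :=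
  ((UniqueFactorizationMonoid.factors β).map fun π => quartic α π).prod

set_option linter.style.haveILetI false
set_option linter.unusedVariables false
set_option linter.unusedSectionVars false
set_option linter.unnecessarySeqFocus false


noncomputable def giBasis : Module.Basis (Fin 2) ℤ ℤ[i] :=
  Module.Basis.ofEquivFun
    { toFun := fun z => ![z.re, z.im]
      map_add' := by intro x y; ext j; fin_cases j <;> simp
      map_smul' := by intro c x; ext j; fin_cases j <;> simp
      invFun := fun v => ⟨v 0, v 1⟩
      left_inv := by intro x; rfl
      right_inv := by intro v; ext j; fin_cases j <;> simp }

lemma gi_repr (z : ℤ[i]) (j : Fin 2) : giBasis.repr z j = ![z.re, z.im] j := rfl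

lemma giBasis_zero : giBasis 0 = 1 := by
  ext <;> simp [giBasis] <;> rfl
lemma giBasis_one : giBasis 1 = gi := by
  ext <;> simp [giBasis, gi] <;> rfl

lemma algNorm_eq (z : ℤ[i]) : Algebra.norm ℤ z = z.norm := by
  rw [Algebra.norm_eq_matrix_det giBasis, Matrix.det_fin_two]
  simp only [Algebra.leftMulMatrix_eq_repr_mul, gi_repr, giBasis_zero, giBasis_one]
  simp [gi, Zsqrtd.norm_def]

lemma card_quot (z : ℤ[i]) : Nat.card (ℤ[i] ⧸ Ideal.span {z}) = z.norm.natAbs := by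
  haveI : Module.Free ℤ ℤ[i] := Module.Free.of_basis giBasis
  haveI : Module.Finite ℤ ℤ[i] := Module.Finite.of_basis giBasis
  rw [← algNorm_eq, ← Ideal.absNorm_span_singleton]
  rfl

lemma gi_sq : gi ^ 2 = -1 := by
  ext <;> simp [gi, pow_two]
lemma gi_mul_gi : gi * gi = -1 := by
  ext <;> simp [gi]
@[simp] lemma gi_re : gi.re = 0 := rfl
@[simp] lemma gi_im : gi.im = 1 := rfl
lemma star_gi : star gi = - gi := by ext <;> simp
lemma norm_eq' (z : ℤ[i]) : z.norm = z.re ^ 2 + z.im ^ 2 := by rw [Zsqrtd.norm_def]; ring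
lemma norm_nn (z : ℤ[i]) : 0 ≤ z.norm := GaussianInt.norm_nonneg z

/-- odd Gaussian integer -/
def GOdd (z : ℤ[i]) : Prop := Odd z.norm

lemma GOdd.mul {x y : ℤ[i]} (hx : GOdd x) (hy : GOdd y) : GOdd (x * y) := by
  unfold GOdd at *; rw [Zsqrtd.norm_mul]; exact hx.mul hy
lemma GOdd.of_mul_left {x y : ℤ[i]} (h : GOdd (x * y)) : GOdd x := by
  unfold GOdd at *; rw [Zsqrtd.norm_mul] at h; exact (Int.odd_mul.1 h).1
lemma GOdd.of_mul_right {x y : ℤ[i]} (h : GOdd (x * y)) : GOdd y := by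
  unfold GOdd at *; rw [Zsqrtd.norm_mul] at h; exact (Int.odd_mul.1 h).2
lemma GOdd.star {x : ℤ[i]} (h : GOdd x) : GOdd (star x) := by
  unfold GOdd at *; rwa [Zsqrtd.norm_conj]
lemma GOdd.ne_zero {x : ℤ[i]} (h : GOdd x) : x ≠ 0 := by
  rintro rfl; simp [GOdd] at h
lemma GOdd.of_dvd {x y : ℤ[i]} (h : GOdd y) (hd : x ∣ y) : GOdd x := by
  obtain ⟨z, rfl⟩ := hd; exact h.of_mul_left
lemma GOdd.norm_mod {x : ℤ[i]} (h : GOdd x) : x.norm % 4 = 1 := by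
  unfold GOdd at h
  rw [norm_eq'] at *
  have key : ∀ y : ℤ, ∃ k, y ^ 2 = 4 * k ∨ y ^ 2 = 4 * k + 1 := by
    intro y
    rcases Int.even_or_odd y with ⟨a, ha⟩ | ⟨a, ha⟩
    · exact ⟨a * a, Or.inl (by rw [ha]; ring)⟩
    · exact ⟨a * a + a, Or.inr (by rw [ha]; ring)⟩
  obtain ⟨k, hk⟩ := key x.re
  obtain ⟨l, hl⟩ := key x.im
  rw [Int.odd_iff] at h
  omega
lemma GOdd.int {n : ℤ} (h : Odd n) : GOdd (n : ℤ[i]) := by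
  unfold GOdd; rw [Zsqrtd.norm_intCast]; exact h.mul h
lemma GOdd.nat {n : ℕ} (h : Odd n) : GOdd (n : ℤ[i]) := by
  unfold GOdd; rw [Zsqrtd.norm_natCast]; exact_mod_cast h.mul h

lemma unit_cases {x : ℤ[i]} (h : x.norm = 1) : x = 1 ∨ x = -1 ∨ x = gi ∨ x = -gi := by
  rw [norm_eq'] at h
  have h1 : x.re ^ 2 ≤ 1 := by nlinarith [sq_nonneg x.im]
  have h2 : x.im ^ 2 ≤ 1 := by nlinarith [sq_nonneg x.re]
  have h3 : -1 ≤ x.re ∧ x.re ≤ 1 := ⟨by nlinarith, by nlinarith⟩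
  have h4 : -1 ≤ x.im ∧ x.im ≤ 1 := ⟨by nlinarith, by nlinarith⟩
  obtain ⟨a, b⟩ := x
  simp only at *
  obtain ⟨h3, h3'⟩ := h3
  obtain ⟨h4, h4'⟩ := h4
  interval_cases a <;> interval_cases b <;> simp [Zsqrtd.ext_iff] at h ⊢

/-- values of the symbol -/
def IsVal (x : ℤ[i]) : Prop := x = 0 ∨ x.norm = 1

lemma IsVal.mul {x y : ℤ[i]} (hx : IsVal x) (hy : IsVal y) : IsVal (x * y) := by
  unfold IsVal at *
  rcases hx with rfl | hx
  · simp
  rcases hy with rfl | hy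
  · simp
  right; rw [Zsqrtd.norm_mul, hx, hy, one_mul]
lemma IsVal.one : IsVal 1 := by right; simp
lemma IsVal.neg_one : IsVal (-1) := by right; simp
lemma IsVal.gi : IsVal gi := by right; simp [norm_eq']
lemma IsVal.pow {x : ℤ[i]} (hx : IsVal x) (n : ℕ) : IsVal (x ^ n) := by
  induction n with
  | zero => simpa using IsVal.one
  | succ n ih => rw [pow_succ]; exact ih.mul hx
lemma IsVal.star {x : ℤ[i]} (hx : IsVal x) : IsVal (star x) := by
  rcases hx with rfl | hx
  · left; simp
  · right; rwa [Zsqrtd.norm_conj]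
lemma IsVal.cases {x : ℤ[i]} (hx : IsVal x) : x = 0 ∨ x = 1 ∨ x = -1 ∨ x = _root_.gi ∨ x = -_root_.gi := by
  rcases hx with rfl | hx
  · simp
  · right; exact unit_cases hx

lemma norm_prime {π : ℤ[i]} (hp : Prime π) (ho : GOdd π) : 5 ≤ π.norm := by
  have h1 := ho.norm_mod
  have h2 := norm_nn π
  have h3 : π.norm ≠ 1 := fun h => hp.not_isUnit ((Zsqrtd.norm_eq_one_iff' (by norm_num) _).1 h)
  omega

lemma not_dvd_small {π x : ℤ[i]} (hp : Prime π) (ho : GOdd π) (h : π ∣ x) (hx : x.norm ∣ 4) : False := by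
  obtain ⟨y, rfl⟩ := h
  rw [Zsqrtd.norm_mul] at hx
  have h1 := norm_prime hp ho
  have h2 := dvd_of_mul_right_dvd hx
  have h3 := ho.norm_mod
  have : π.norm ≤ 4 := Int.le_of_dvd (by norm_num) h2
  omega

lemma IsVal.eq_of_dvd {π x y : ℤ[i]} (hp : Prime π) (ho : GOdd π) (hx : IsVal x) (hy : IsVal y)
    (h : π ∣ x - y) : x = y := by
  by_contra hne
  refine not_dvd_small hp ho h ?_
  rcases hx.cases with rfl | rfl | rfl | rfl | rfl <;> rcases hy.cases with rfl | rfl | rfl | rfl | rfl <;>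
    first | exact absurd rfl hne | (simp [norm_eq']; try decide)

lemma two_not_dvd {π : ℤ[i]} (hp : Prime π) (ho : GOdd π) : ¬ π ∣ 2 := fun h =>
  not_dvd_small hp ho h (by decide)

/-- exponent -/
def qe (π : ℤ[i]) : ℕ := (π.norm.natAbs - 1) / 4

lemma four_qe {π : ℤ[i]} (ho : GOdd π) : 4 * qe π + 1 = π.norm.natAbs := by
  have := ho.norm_mod
  have := norm_nn π
  unfold qe; omega

lemma finite_quot {π : ℤ[i]} (h : π ≠ 0) : Finite (ℤ[i] ⧸ Ideal.span {π}) := by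
  apply Nat.finite_of_card_ne_zero
  rw [card_quot]
  simp [Int.natAbs_eq_zero, GaussianInt.norm_eq_zero, h]

lemma isField_quot {π : ℤ[i]} (hp : Prime π) : (Ideal.span {π}).IsMaximal :=
  PrincipalIdealRing.isMaximal_of_irreducible hp.irreducible

lemma mk_eq_zero_iff {π : ℤ[i]} (x : ℤ[i]) : Ideal.Quotient.mk (Ideal.span {π}) x = 0 ↔ π ∣ x := by
  rw [Ideal.Quotient.eq_zero_iff_mem, Ideal.mem_span_singleton]
lemma mk_eq_iff {π : ℤ[i]} (x y : ℤ[i]) : Ideal.Quotient.mk (Ideal.span {π}) x = Ideal.Quotient.mk (Ideal.span {π}) y ↔ π ∣ x - y := by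
  rw [Ideal.Quotient.eq, Ideal.mem_span_singleton]

lemma fermat {π : ℤ[i]} (hp : Prime π) (ho : GOdd π) {α : ℤ[i]} (h : ¬ π ∣ α) :
    π ∣ α ^ (4 * qe π) - 1 := by
  haveI := isField_quot hp
  letI := Ideal.Quotient.field (Ideal.span {π})
  haveI := finite_quot hp.ne_zero
  letI := Fintype.ofFinite (ℤ[i] ⧸ Ideal.span {π})
  rw [← mk_eq_iff, map_pow, map_one]
  have := FiniteField.pow_card_sub_one_eq_one (Ideal.Quotient.mk (Ideal.span {π}) α) (by rwa [Ne, mk_eq_zero_iff])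
  rw [← Nat.card_eq_fintype_card, card_quot, ← four_qe ho] at this
  simpa using this

lemma quartic_ex {π : ℤ[i]} (hp : Prime π) (ho : GOdd π) {α : ℤ[i]} (h : ¬ π ∣ α) :
    ∃ k : Fin 4, π ∣ α ^ (qe π) - gi ^ (k : ℕ) := by
  have h1 := fermat hp ho h
  have h2 : α ^ (4 * qe π) - 1 = (α ^ qe π - gi ^ 0) * (α ^ qe π - gi ^ 2) * ((α ^ qe π - gi ^ 1) * (α ^ qe π - gi ^ 3)) := by
    rw [mul_comm 4, pow_mul]
    have := gi_sq
    have h3 : gi ^ 3 = -gi := by rw [pow_succ, this]; ring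
    rw [h3, this, pow_zero, pow_one]
    generalize α ^ qe π = y
    linear_combination (y ^ 2 - 1) * this
  rw [h2] at h1
  rcases hp.dvd_or_dvd h1 with h | h <;> rcases hp.dvd_or_dvd h with h | h
  · exact ⟨0, h⟩
  · exact ⟨2, h⟩
  · exact ⟨1, h⟩
  · exact ⟨3, h⟩

lemma quartic_spec {π : ℤ[i]} (hp : Prime π) (ho : GOdd π) (α : ℤ[i]) :
    π ∣ α ^ (qe π) - quartic α π ∧ IsVal (quartic α π) := by
  unfold quartic
  rw [card_quot]
  rw [show (π.norm.natAbs - 1) / 4 = qe π from rfl]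
  split_ifs with h
  · exact ⟨h.choose_spec, IsVal.gi.pow _⟩
  · refine ⟨?_, Or.inl rfl⟩
    have : π ∣ α := by
      by_contra hd
      exact h (quartic_ex hp ho hd)
    rw [sub_zero]
    refine dvd_pow this ?_
    have := four_qe ho
    have := norm_prime hp ho
    omega

lemma quartic_unique {π : ℤ[i]} (hp : Prime π) (ho : GOdd π) {α x : ℤ[i]} (hx : IsVal x)
    (h : π ∣ α ^ (qe π) - x) : quartic α π = x := by
  obtain ⟨h1, h2⟩ := quartic_spec hp ho α
  refine IsVal.eq_of_dvd hp ho h2 hx ?_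
  have := dvd_sub h h1
  rwa [sub_sub_sub_cancel_left] at this

lemma quartic_mul {π : ℤ[i]} (hp : Prime π) (ho : GOdd π) (α β : ℤ[i]) :
    quartic (α * β) π = quartic α π * quartic β π := by
  obtain ⟨h1, h2⟩ := quartic_spec hp ho α
  obtain ⟨h3, h4⟩ := quartic_spec hp ho β
  refine quartic_unique hp ho (h2.mul h4) ?_
  rw [mul_pow]
  have : α ^ qe π * β ^ qe π - quartic α π * quartic β π =
    (α ^ qe π - quartic α π) * β ^ qe π + quartic α π * (β ^ qe π - quartic β π) := by ring
  rw [this]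
  exact dvd_add (h1.mul_right _) (h3.mul_left _)

lemma quartic_one {π : ℤ[i]} (hp : Prime π) (ho : GOdd π) : quartic 1 π = 1 :=
  quartic_unique hp ho IsVal.one (by simp)

lemma quartic_congr {π : ℤ[i]} (hp : Prime π) (ho : GOdd π) {α β : ℤ[i]} (h : π ∣ α - β) :
    quartic α π = quartic β π := by
  obtain ⟨h3, h4⟩ := quartic_spec hp ho β
  refine quartic_unique hp ho h4 ?_
  have := dvd_add (h.trans (sub_dvd_pow_sub_pow α β (qe π))) h3
  rwa [sub_add_sub_cancel] at this

lemma quartic_eq_zero_iff {π : ℤ[i]} (hp : Prime π) (ho : GOdd π) {α : ℤ[i]} :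
    quartic α π = 0 ↔ π ∣ α := by
  obtain ⟨h1, h2⟩ := quartic_spec hp ho α
  constructor
  · intro h
    rw [h, sub_zero] at h1
    exact hp.dvd_of_dvd_pow h1
  · intro h
    refine quartic_unique hp ho (Or.inl rfl) ?_
    rw [sub_zero]
    refine dvd_pow h ?_
    have := four_qe ho
    have := norm_prime hp ho
    omega

lemma norm_assoc {x y : ℤ[i]} (h : Associated x y) : x.norm = y.norm :=
  Zsqrtd.norm_eq_of_associated (by norm_num) h

lemma quartic_assoc {π π' : ℤ[i]} (hp : Prime π) (ho : GOdd π) (h : Associated π π') (α : ℤ[i]) :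
    quartic α π = quartic α π' := by
  have hp' := h.prime hp
  have ho' : GOdd π' := by unfold GOdd at *; rwa [← norm_assoc h]
  obtain ⟨h3, h4⟩ := quartic_spec hp' ho' α
  refine quartic_unique hp ho h4 ?_
  have : qe π = qe π' := by unfold qe; rw [norm_assoc h]
  rw [this]
  exact h.dvd.trans h3

lemma star_dvd {x y : ℤ[i]} (h : x ∣ y) : star x ∣ star y := map_dvd (starRingEnd ℤ[i]) h

lemma Prime.gstar {π : ℤ[i]} (hp : Prime π) : Prime (star π) := by
  refine ⟨fun h => hp.ne_zero (by simpa using h), fun h => hp.not_isUnit ?_, fun a b h => ?_⟩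
  · have h2 : IsUnit (star (star π)) := h.map (starRingEnd ℤ[i])
    rwa [star_star] at h2
  · have := star_dvd h
    rw [star_star, star_mul'] at this
    rcases hp.dvd_or_dvd this with h | h
    · left; simpa using star_dvd h
    · right; simpa using star_dvd h

lemma quartic_star {π : ℤ[i]} (hp : Prime π) (ho : GOdd π) (α : ℤ[i]) :
    quartic (star α) (star π) = star (quartic α π) := by
  obtain ⟨h3, h4⟩ := quartic_spec hp ho α
  refine quartic_unique hp.gstar ho.star h4.star ?_
  have : qe (star π) = qe π := by unfold qe; rw [Zsqrtd.norm_conj]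
  rw [this]
  have := star_dvd h3
  rwa [star_sub, star_pow] at this

lemma IsVal.mul_star {x : ℤ[i]} (hx : IsVal x) (h0 : x ≠ 0) : x * Star.star x = 1 := by
  have := hx.resolve_left h0
  rw [← Zsqrtd.norm_eq_mul_conj, this]; simp
lemma IsVal.pow_four {x : ℤ[i]} (hx : IsVal x) (h0 : x ≠ 0) : x ^ 4 = 1 := by
  have := hx.cases
  rcases this with rfl | rfl | rfl | rfl | rfl
  · exact absurd rfl h0
  all_goals (ext <;> simp [pow_succ])

open UniqueFactorizationMonoid

lemma quarticGen_eq_of_rel {s t : Multiset ℤ[i]} (α : ℤ[i]) (h : Multiset.Rel Associated s t)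
    (hs : ∀ p ∈ s, Prime p ∧ GOdd p) :
    (s.map fun π => quartic α π).prod = (t.map fun π => quartic α π).prod := by
  induction h with
  | zero => rfl
  | cons hab _ ih =>
    rename_i a b as bs hr
    rw [Multiset.map_cons, Multiset.map_cons, Multiset.prod_cons, Multiset.prod_cons]
    rw [ih (fun p hp => hs p (Multiset.mem_cons_of_mem hp))]
    obtain ⟨h1, h2⟩ := hs a (Multiset.mem_cons_self _ _)
    rw [quartic_assoc h1 h2 hab]

lemma factors_good {β : ℤ[i]} (h : GOdd β) : ∀ p ∈ factors β, Prime p ∧ GOdd p := fun p hp =>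
  ⟨prime_of_factor p hp, h.of_dvd (dvd_of_mem_factors hp)⟩

lemma S_mul_right {β γ : ℤ[i]} (hβ : GOdd β) (hγ : GOdd γ) (α : ℤ[i]) :
    quarticGen α (β * γ) = quarticGen α β * quarticGen α γ := by
  unfold quarticGen
  rw [← Multiset.prod_add, ← Multiset.map_add]
  exact quarticGen_eq_of_rel α (factors_mul hβ.ne_zero hγ.ne_zero) (factors_good (hβ.mul hγ))

lemma S_unit {u : ℤ[i]} (hu : IsUnit u) (α : ℤ[i]) : quarticGen α u = 1 := by
  unfold quarticGen
  have : factors u = 0 := by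
    by_contra h
    obtain ⟨p, hp⟩ := Multiset.exists_mem_of_ne_zero h
    exact (prime_of_factor p hp).not_isUnit (isUnit_of_dvd_unit (dvd_of_mem_factors hp) hu)
  rw [this]; simp

lemma S_prime {π : ℤ[i]} (hp : Prime π) (ho : GOdd π) (α : ℤ[i]) :
    quarticGen α π = quartic α π := by
  unfold quarticGen
  have hr : Multiset.Rel Associated (factors π) {π} := by
    refine factors_unique (fun x hx => irreducible_of_factor x hx) ?_ ?_
    · intro x hx
      rw [Multiset.mem_singleton.1 hx]; exact hp.irreducible
    · rw [Multiset.prod_singleton]; exact factors_prod hp.ne_zero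
  rw [quarticGen_eq_of_rel α hr (factors_good ho)]; simp

lemma GOdd.unit {u : ℤ[i]} (hu : IsUnit u) : GOdd u := by
  have := (Zsqrtd.norm_eq_one_iff' (by norm_num) u).2 hu
  unfold GOdd; rw [this]; exact odd_one

lemma S_assoc {β β' : ℤ[i]} (hβ : GOdd β) (h : Associated β β') (α : ℤ[i]) :
    quarticGen α β = quarticGen α β' := by
  obtain ⟨u, rfl⟩ := h
  rw [S_mul_right hβ (GOdd.unit u.isUnit), S_unit u.isUnit, mul_one]

/-- induction over odd elements -/
lemma odd_induction {Q : ℤ[i] → Prop} (h1 : ∀ u, IsUnit u → Q u)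
    (hp : ∀ p, Prime p → GOdd p → Q p)
    (hm : ∀ p x, GOdd p → GOdd x → Q p → Q x → Q (p * x)) : ∀ x, GOdd x → Q x := by
  intro x
  induction x using UniqueFactorizationMonoid.induction_on_prime with
  | h₁ => intro h; exact absurd rfl h.ne_zero
  | h₂ x hx => intro _; exact h1 x hx
  | h₃ a p ha hpp ih =>
    intro ho
    exact hm p a ho.of_mul_left ho.of_mul_right (hp p hpp ho.of_mul_left) (ih ho.of_mul_right)

lemma S_val {β : ℤ[i]} (hβ : GOdd β) (α : ℤ[i]) : IsVal (quarticGen α β) := by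
  revert hβ
  generalize β = b
  revert b
  refine odd_induction ?_ ?_ ?_
  · intro u hu; rw [S_unit hu]; exact IsVal.one
  · intro p hp ho; rw [S_prime hp ho]; exact (quartic_spec hp ho α).2
  · intro p x h1 h2 h3 h4; rw [S_mul_right h1 h2]; exact h3.mul h4

lemma S_mul_left {β : ℤ[i]} (hβ : GOdd β) (α α' : ℤ[i]) :
    quarticGen (α * α') β = quarticGen α β * quarticGen α' β := by
  revert hβ
  generalize β = b
  revert b
  refine odd_induction ?_ ?_ ?_
  · intro u hu; simp [S_unit hu]
  · intro p hp ho; simp only [S_prime hp ho]; exact quartic_mul hp ho _ _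
  · intro p x h1 h2 h3 h4; simp only [S_mul_right h1 h2]; rw [h3, h4]; ring

lemma S_congr {β : ℤ[i]} (hβ : GOdd β) {α α' : ℤ[i]} (h : β ∣ α - α') :
    quarticGen α β = quarticGen α' β := by
  revert h
  revert hβ
  generalize β = b
  revert b
  refine odd_induction ?_ ?_ ?_
  · intro u hu _; simp [S_unit hu]
  · intro p hp ho h; simp only [S_prime hp ho]; exact quartic_congr hp ho h
  · intro p x h1 h2 h3 h4 h; simp only [S_mul_right h1 h2]
    rw [h3 (dvd_of_mul_right_dvd h), h4 (dvd_of_mul_left_dvd h)]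

lemma S_star {β : ℤ[i]} (hβ : GOdd β) (α : ℤ[i]) :
    quarticGen (star α) (star β) = star (quarticGen α β) := by
  revert hβ
  generalize β = b
  revert b
  refine odd_induction ?_ ?_ ?_
  · intro u hu
    have hu' : IsUnit (star u) := hu.map (starRingEnd ℤ[i])
    simp [S_unit hu, S_unit hu']
  · intro p hp ho; rw [S_prime hp ho, S_prime hp.gstar ho.star]; exact quartic_star hp ho _
  · intro p x h1 h2 h3 h4
    rw [star_mul', S_mul_right h1.star h2.star, S_mul_right h1 h2, h3, h4, star_mul']

lemma S_ne_zero {β : ℤ[i]} (hβ : GOdd β) {α : ℤ[i]} (h : IsCoprime α β) :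
    quarticGen α β ≠ 0 := by
  revert h
  revert hβ
  generalize β = b
  revert b
  refine odd_induction ?_ ?_ ?_
  · intro u hu _; simp [S_unit hu]
  · intro p hp ho h; rw [S_prime hp ho, Ne, quartic_eq_zero_iff hp ho]
    intro hd
    exact hp.not_isUnit (h.symm.isUnit_of_dvd' dvd_rfl hd)
  · intro p x h1 h2 h3 h4 h; rw [S_mul_right h1 h2]
    exact mul_ne_zero (h3 h.of_mul_right_left) (h4 h.of_mul_right_right)

lemma S_one {β : ℤ[i]} (hβ : GOdd β) : quarticGen 1 β = 1 := by
  revert hβ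
  generalize β = b
  revert b
  refine odd_induction ?_ ?_ ?_
  · intro u hu; simp [S_unit hu]
  · intro p hp ho; rw [S_prime hp ho, quartic_one hp ho]
  · intro p x h1 h2 h3 h4; rw [S_mul_right h1 h2, h3, h4, one_mul]

lemma gi_pow_four : gi ^ 4 = 1 := by ext <;> simp [pow_succ]

lemma S_gi {β : ℤ[i]} (hβ : GOdd β) : quarticGen gi β = gi ^ qe β := by
  revert hβ
  generalize β = b
  revert b
  refine odd_induction ?_ ?_ ?_
  · intro u hu
    have := (Zsqrtd.norm_eq_one_iff' (by norm_num) u).2 hu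
    simp [S_unit hu, qe, this]
  · intro p hp ho; rw [S_prime hp ho]
    exact quartic_unique hp ho (IsVal.gi.pow _) (by simp)
  · intro p x h1 h2 h3 h4
    rw [S_mul_right h1 h2, h3, h4, ← pow_add]
    have e1 := four_qe h1
    have e2 := four_qe h2
    have e3 := four_qe (h1.mul h2)
    rw [Zsqrtd.norm_mul, Int.natAbs_mul, ← e1, ← e2] at e3
    have : qe (p * x) = (qe p + qe x) + 4 * (qe p * qe x) := by nlinarith
    rw [this, pow_add _ (qe p + qe x), pow_mul gi 4, gi_pow_four]; simp

lemma S_neg_one {β : ℤ[i]} (hβ : GOdd β) : quarticGen (-1) β = (-1) ^ qe β := by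
  rw [← gi_mul_gi, S_mul_left hβ, S_gi hβ, ← mul_pow]

section Chi
variable {F : Type} [Field F] [Fintype F] {f : ℤ[i] →+* F} {l : ℤ[i]}

lemma card_F (hf : Function.Surjective f) (hk : ∀ x, f x = 0 ↔ l ∣ x) :
    Fintype.card F = l.norm.natAbs := by
  rw [← card_quot, ← Nat.card_eq_fintype_card]
  have : RingHom.ker f = Ideal.span {l} := by
    ext x; rw [RingHom.mem_ker, hk, Ideal.mem_span_singleton]
  rw [← this]
  exact (Nat.card_congr (RingHom.quotientKerEquivOfSurjective hf).toEquiv).symm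

lemma exists_chi (hf : Function.Surjective f) (hk : ∀ x, f x = 0 ↔ l ∣ x) (hp : Prime l) (ho : GOdd l) :
    ∃ χ : MulChar F ℤ[i], ∀ x, χ (f x) = quartic x l := by
  classical
  have key : ∀ x y, f x = f y → quartic x l = quartic y l := by
    intro x y h
    apply quartic_congr hp ho
    rw [← hk, map_sub, h, sub_self]
  let g := Function.surjInv hf
  have hg : ∀ x, f (g x) = x := Function.surjInv_eq hf
  refine ⟨{ toFun := fun x => quartic (g x) l, map_one' := ?_, map_mul' := ?_, map_nonunit' := ?_ }, ?_⟩
  · rw [key (g 1) 1 (by rw [hg, map_one]), quartic_one hp ho]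
  · intro x y
    rw [← quartic_mul hp ho]
    exact key _ _ (by rw [map_mul, hg, hg, hg])
  · intro a ha
    have : a = 0 := by by_contra h; exact ha (isUnit_iff_ne_zero.2 h)
    change quartic (g a) l = 0
    rw [quartic_eq_zero_iff hp ho, ← hk, hg, this]
  · intro x
    exact key _ _ (hg _)

variable {χ : MulChar F ℤ[i]}

lemma chi_val (hf : Function.Surjective f) (hp : Prime l) (ho : GOdd l)
    (hχ : ∀ x, χ (f x) = quartic x l) (x : F) : IsVal (χ x) := by
  obtain ⟨y, rfl⟩ := hf x
  rw [hχ]; exact (quartic_spec hp ho y).2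

lemma chi_f (hf : Function.Surjective f) (hk : ∀ x, f x = 0 ↔ l ∣ x) (hp : Prime l) (ho : GOdd l)
    (hχ : ∀ x, χ (f x) = quartic x l) (x : F) : f (χ x) = x ^ qe l := by
  obtain ⟨y, rfl⟩ := hf x
  have := (quartic_spec hp ho y).1
  rw [← hk, map_sub, map_pow, sub_eq_zero] at this
  rw [hχ, this]

lemma chi_ne {x : F} (hx : x ≠ 0) : χ x ≠ 0 := by
  have := (isUnit_iff_ne_zero.2 hx).map χ
  exact this.ne_zero

lemma chi_four (hf : Function.Surjective f) (hp : Prime l) (ho : GOdd l)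
    (hχ : ∀ x, χ (f x) = quartic x l) : χ ^ 4 = 1 := by
  refine MulChar.ext fun a => ?_
  rw [MulChar.pow_apply_coe, MulChar.one_apply_coe]
  exact (chi_val hf hp ho hχ _).pow_four (chi_ne a.ne_zero)

lemma F_two (hk : ∀ x, f x = 0 ↔ l ∣ x) (hp : Prime l) (ho : GOdd l) : (2 : F) ≠ 0 := by
  have := two_not_dvd hp ho
  rw [← hk, show (2 : ℤ[i]) = 1 + 1 by ext <;> simp, map_add, map_one] at this
  rwa [one_add_one_eq_two] at this

lemma chi_sq_ne (hf : Function.Surjective f) (hk : ∀ x, f x = 0 ↔ l ∣ x) (hp : Prime l) (ho : GOdd l)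
    (hχ : ∀ x, χ (f x) = quartic x l) : χ * χ ≠ 1 := by
  intro h
  have h2 : ringChar F ≠ 2 := by
    intro h2
    apply F_two hk hp ho
    have := ringChar.Nat.cast_ringChar (R := F)
    rw [h2] at this; exact_mod_cast this
  obtain ⟨a, ha⟩ := FiniteField.exists_nonsquare h2
  have ha0 : a ≠ 0 := by rintro rfl; exact ha (IsSquare.zero)
  apply ha
  rw [FiniteField.isSquare_iff h2 ha0]
  have h3 : (χ * χ) a = 1 := by
    rw [h]; exact MulChar.one_apply (isUnit_iff_ne_zero.2 ha0)
  have h4 := congrArg f h3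
  rw [MulChar.mul_apply, map_mul, chi_f hf hk hp ho hχ, map_one, ← pow_add] at h4
  rw [card_F hf hk, ← four_qe ho, ← h4]
  congr 1; omega

lemma chi_neg_one (hf : Function.Surjective f) (hp : Prime l) (ho : GOdd l)
    (hχ : ∀ x, χ (f x) = quartic x l) : χ (-1) * χ (-1) = 1 := by
  rw [← map_mul]; simp

lemma chi_two (hf : Function.Surjective f) (hk : ∀ x, f x = 0 ↔ l ∣ x) (hp : Prime l) (ho : GOdd l)
    (hχ : ∀ x, χ (f x) = quartic x l) : χ 2 * χ 2 = χ (-1) := by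
  have h1 : (-1 : F) * (2 * 2) = f (1 + gi) ^ 4 := by
    rw [← map_pow]
    have : (1 + gi) ^ 4 = -4 := by ext <;> simp [pow_succ]
    rw [this, show (-4 : ℤ[i]) = -(1 + 1 + 1 + 1) by ext <;> simp]
    simp only [map_neg, map_add, map_one]; norm_num
  have h2 : f (1 + gi) ≠ 0 := by
    intro h
    rw [h] at h1
    have := F_two hk hp ho
    simp [this] at h1
  have h3 := congrArg χ h1
  rw [map_mul, map_pow, (chi_val hf hp ho hχ _).pow_four (chi_ne h2), map_mul] at h3
  have h4 := chi_neg_one hf hp ho hχ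
  linear_combination χ (-1) * h3 - χ 2 * χ 2 * h4

lemma jacobi_dvd (hf : Function.Surjective f) (hk : ∀ x, f x = 0 ↔ l ∣ x) (hp : Prime l) (ho : GOdd l)
    (hχ : ∀ x, χ (f x) = quartic x l) : l ∣ jacobiSum χ χ := by
  rw [← hk, jacobiSum, map_sum]
  have : ∀ x : F, f (χ x * χ (1 - x)) = ∑ m ∈ Finset.range (qe l + 1),
      ((-1) ^ m * ((qe l).choose m : F)) * x ^ (qe l + m) := by
    intro x
    rw [map_mul, chi_f hf hk hp ho hχ, chi_f hf hk hp ho hχ, show (1 - x) = -x + 1 by ring, add_pow,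
      Finset.mul_sum]
    refine Finset.sum_congr rfl fun m _ => ?_
    rw [neg_pow, pow_add]; ring
  rw [Finset.sum_congr rfl (fun x _ => this x), Finset.sum_comm]
  refine Finset.sum_eq_zero fun m hm => ?_
  rw [← Finset.mul_sum, FiniteField.sum_pow_lt_card_sub_one, mul_zero]
  rw [card_F hf hk, ← four_qe ho]
  have := Finset.mem_range.1 hm
  have := four_qe ho
  have := norm_prime hp ho
  omega

lemma chi_inv (hf : Function.Surjective f) (hp : Prime l) (ho : GOdd l)
    (hχ : ∀ x, χ (f x) = quartic x l) (x : F) : χ⁻¹ x = star (χ x) := by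
  rw [MulChar.inv_apply']
  by_cases hx : x = 0
  · rw [hx, inv_zero, MulChar.map_zero, star_zero]
  · have h1 := (chi_val hf hp ho hχ x).mul_star (chi_ne hx)
    have h2 : χ x * χ x⁻¹ = 1 := by rw [← map_mul, mul_inv_cancel₀ hx, map_one]
    have := chi_ne (χ := χ) hx
    exact mul_left_cancel₀ this (h2.trans h1.symm)

lemma jacobi_norm (hf : Function.Surjective f) (hk : ∀ x, f x = 0 ↔ l ∣ x) (hp : Prime l) (ho : GOdd l)
    (hχ : ∀ x, χ (f x) = quartic x l) : (jacobiSum χ χ).norm = l.norm := by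
  have hinj := GaussianInt.toComplex_injective
  have h1 : jacobiSum χ⁻¹ χ⁻¹ = star (jacobiSum χ χ) := by
    rw [jacobiSum, jacobiSum, star_sum]
    refine Finset.sum_congr rfl fun x _ => ?_
    rw [chi_inv hf hp ho hχ, chi_inv hf hp ho hχ, star_mul']
  have hsq := chi_sq_ne hf hk hp ho hχ
  have hne : χ ≠ 1 := by rintro rfl; exact hsq (one_mul _)
  have hch : ringChar ℂ ≠ ringChar F := by
    intro h
    have h0 : ringChar ℂ = 0 := ringChar.eq_zero
    rw [h0] at h
    exact (CharP.char_ne_zero_of_finite F (ringChar F)) h.symm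
  have hne' := (MulChar.ringHomComp_ne_one_iff (χ := χ) hinj).2 hne
  have h2 := jacobiSum_mul_jacobiSum_inv hch hne' hne' (by
    rw [← MulChar.ringHomComp_mul]; exact (MulChar.ringHomComp_ne_one_iff hinj).2 hsq)
  rw [MulChar.ringHomComp_inv, jacobiSum_ringHomComp, jacobiSum_ringHomComp, h1, ← map_mul,
    ← Zsqrtd.norm_eq_mul_conj, card_F hf hk] at h2
  have h3 : ((jacobiSum χ χ).norm : ℂ) = ((l.norm.natAbs : ℤ) : ℂ) := by
    rw [map_intCast] at h2
    rw [h2]; simp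
  have h4 : (jacobiSum χ χ).norm = (l.norm.natAbs : ℤ) := by exact_mod_cast h3
  rw [h4]; exact Int.natAbs_of_nonneg (norm_nn _)

lemma val_odd {x : ℤ[i]} (hx : IsVal x) (h0 : x ≠ 0) : (1 + gi) ∣ x - 1 := by
  rcases hx.cases with rfl | rfl | rfl | rfl | rfl
  · exact absurd rfl h0
  · simp
  · exact ⟨-1 + gi, by ext <;> simp⟩
  · exact ⟨gi, by ext <;> simp⟩
  · exact ⟨-1, by ext <;> simp⟩

lemma jacobi_primary (hf : Function.Surjective f) (hk : ∀ x, f x = 0 ↔ l ∣ x) (hp : Prime l) (ho : GOdd l)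
    (hχ : ∀ x, χ (f x) = quartic x l) : 2 * (1 + gi) ∣ -χ (-1) * jacobiSum χ χ - 1 := by
  classical
  have h2 := F_two hk hp ho
  let S : Finset F := Finset.univ \ {0, 1, 2⁻¹}
  have hS : ∀ x, x ∈ S ↔ x ≠ 0 ∧ x ≠ 1 ∧ x ≠ 2⁻¹ := by intro x; simp [S]
  have h12 : (1 : F) ≠ 2⁻¹ := by
    intro h; field_simp at h; norm_num at h
    have : (2 : F) - 1 = 0 := by rw [h]; ring
    norm_num at this
  have h02 : (0 : F) ≠ 2⁻¹ := (inv_ne_zero h2).symm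
  have hcard3 : ({0, 1, 2⁻¹} : Finset F).card = 3 := by
    rw [Finset.card_eq_three]; exact ⟨0, 1, 2⁻¹, zero_ne_one, h02, h12, rfl⟩
  have hcard : S.card + 3 = Fintype.card F := by
    rw [← hcard3, Finset.card_sdiff_add_card_eq_card (Finset.subset_univ _), Finset.card_univ]
  have hJ : jacobiSum χ χ = ∑ x ∈ S, (χ x * χ (1 - x) - 1) + S.card + χ (-1) := by
    rw [jacobiSum, ← Finset.sum_sdiff (Finset.subset_univ ({0, 1, 2⁻¹} : Finset F)),
      Finset.sum_sub_distrib]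
    have h3 : ∑ x ∈ ({0, 1, 2⁻¹} : Finset F), χ x * χ (1 - x) = χ (-1) := by
      rw [Finset.sum_insert, Finset.sum_insert, Finset.sum_singleton]
      · have : (1 : F) - 2⁻¹ = 2⁻¹ := by field_simp; norm_num
        rw [this, MulChar.map_zero, sub_self, MulChar.map_zero]
        have h4 := chi_two hf hk hp ho hχ
        have h5 : χ 2 * χ 2⁻¹ = 1 := by rw [← map_mul, mul_inv_cancel₀ h2, map_one]
        have h6 := chi_neg_one hf hp ho hχ
        linear_combination (-(χ 2⁻¹)^2 * χ (-1)) * h4 + χ (-1) * (χ 2 * χ 2⁻¹ + 1) * h5 - (χ 2⁻¹)^2 * h6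
      · simpa using h12
      · simpa using h2.symm
    rw [h3]; simp [S]
  have hsum : 2 * (1 + gi) ∣ ∑ x ∈ S, (χ x * χ (1 - x) - 1) := by
    have hd : ∀ x ∈ S, (1 + gi) ∣ χ x * χ (1 - x) - 1 := by
      intro x hx
      obtain ⟨h0, h1, _⟩ := (hS x).1 hx
      exact val_odd ((chi_val hf hp ho hχ _).mul (chi_val hf hp ho hχ _))
        (mul_ne_zero (chi_ne h0) (chi_ne (sub_ne_zero.2 h1.symm)))
    rw [← mk_eq_zero_iff, map_sum]
    refine Finset.sum_involution (fun x _ => 1 - x) ?_ ?_ ?_ ?_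
    · intro x hx
      rw [← map_add, mk_eq_zero_iff]
      obtain ⟨y, hy⟩ := hd x hx
      refine ⟨y, ?_⟩
      rw [sub_sub_cancel]
      linear_combination 2 * hy
    · intro x hx _ h
      refine ((hS x).1 hx).2.2 ?_
      rw [← mul_eq_one_iff_eq_inv₀ h2]
      linear_combination -h
    · intro x hx
      rw [hS] at hx ⊢
      obtain ⟨h0, h1, h3⟩ := hx
      refine ⟨sub_ne_zero.2 h1.symm, fun h => h0 (by linear_combination -h), fun h => h3 ?_⟩
      rw [← mul_eq_one_iff_eq_inv₀ h2] at h ⊢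
      linear_combination -h
    · intro x hx; exact sub_sub_cancel _ _
  have hN : ∃ k : ℕ, S.card = 4 * k + 2 := by
    have := four_qe ho
    have := norm_prime hp ho
    rw [card_F hf hk] at hcard
    exact ⟨qe l - 1, by omega⟩
  obtain ⟨k, hk'⟩ := hN
  obtain ⟨y, hy⟩ := hsum
  rw [hJ, hy, hk']
  have h4 : (4 : ℤ[i]) = 2 * (1 + gi) * (1 - gi) := by ext <;> simp
  have h6 := chi_neg_one hf hp ho hχ
  have h7 : χ (-1) = 1 ∨ χ (-1) = -1 := mul_self_eq_one_iff.1 h6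
  rcases h7 with h7 | h7
  · rw [h7]
    refine ⟨-y - (1 - gi) * k - (1 - gi), ?_⟩
    push_cast
    linear_combination (-(k : ℤ[i]) - 1) * h4
  · rw [h7]
    refine ⟨y + (1 - gi) * k, ?_⟩
    push_cast
    linear_combination (k : ℤ[i]) * h4

lemma primary_odd {l : ℤ[i]} (h : IsPrimary l) : GOdd l := by
  obtain ⟨y, hy⟩ := h
  have : l = 1 + 2 * (1 + gi) * y := by linear_combination hy
  unfold GOdd
  rw [norm_eq', this]
  simp
  ring_nf
  rw [Int.odd_iff]; omega

lemma primary_unit {u : ℤ[i]} (hu : u.norm = 1) (h : 2 * (1 + gi) ∣ u - 1) : u = 1 := by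
  rcases unit_cases hu with rfl | rfl | rfl | rfl
  · rfl
  all_goals
    exfalso
    obtain ⟨y, hy⟩ := h
    have h1 := congrArg Zsqrtd.re hy
    have h2 := congrArg Zsqrtd.im hy
    simp at h1 h2
    omega

lemma jacobi_eq (hf : Function.Surjective f) (hk : ∀ x, f x = 0 ↔ l ∣ x) (hp : Prime l) (hl : IsPrimary l)
    (hχ : ∀ x, χ (f x) = quartic x l) : jacobiSum χ χ = -χ (-1) * l := by
  have ho := primary_odd hl
  obtain ⟨u, hu⟩ := jacobi_dvd hf hk hp ho hχ
  have h1 := jacobi_norm hf hk hp ho hχ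
  have h2 := jacobi_primary hf hk hp ho hχ
  have h6 := chi_neg_one hf hp ho hχ
  have hun : u.norm = 1 := by
    rw [hu, Zsqrtd.norm_mul] at h1
    have := norm_prime hp ho
    exact mul_left_cancel₀ (show l.norm ≠ 0 by omega) (by rw [h1, mul_one])
  have h7 : (-χ (-1) * u) = 1 := by
    apply primary_unit
    · rw [Zsqrtd.norm_mul, Zsqrtd.norm_neg, hun]
      have := (chi_val hf hp ho hχ (-1)).resolve_left (chi_ne (by simp))
      rw [this, one_mul]
    · rw [hu] at h2
      unfold IsPrimary at hl
      have : -χ (-1) * u - 1 = (-χ (-1) * (l * u) - 1) - (-χ (-1) * u) * (l - 1) := by ring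
      rw [this]
      exact dvd_sub h2 (hl.mul_left _)
  rw [hu]
  linear_combination (-χ (-1) * l) * h7 - l * u * h6
end Chi

section Gauss
variable {F : Type} [Field F] [Fintype F] {f : ℤ[i] →+* F} {l : ℤ[i]} {χ : MulChar F ℤ[i]}
variable {K : Type} [Field K] (φ : ℤ[i] →+* K)

lemma comp_sq_ne (h2 : (2 : K) ≠ 0) (hf : Function.Surjective f) (hk : ∀ x, f x = 0 ↔ l ∣ x) (hp : Prime l)
    (ho : GOdd l) (hχ : ∀ x, χ (f x) = quartic x l) :
    χ.ringHomComp φ * χ.ringHomComp φ ≠ 1 := by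
  intro h
  apply chi_sq_ne hf hk hp ho hχ
  refine MulChar.ext fun a => ?_
  have h1 := congrArg (fun c : MulChar F K => c a) h
  simp only [MulChar.mul_apply, MulChar.ringHomComp_apply, MulChar.one_apply_coe] at h1 ⊢
  have h3 := (chi_val hf hp ho hχ (a : F)).pow_four (chi_ne a.ne_zero)
  have h4 : (χ a * χ a) * (χ a * χ a) = 1 := by linear_combination h3
  rcases mul_self_eq_one_iff.1 h4 with h5 | h5
  · exact h5
  · exfalso
    rw [← map_mul, h5, map_neg, map_one] at h1
    apply h2
    linear_combination -h1

lemma gauss_four (h2 : (2 : K) ≠ 0) (hf : Function.Surjective f) (hk : ∀ x, f x = 0 ↔ l ∣ x) (hp : Prime l)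
    (hl : IsPrimary l) (hχ : ∀ x, χ (f x) = quartic x l) {ψ : AddChar F K} (hψ : ψ.IsPrimitive) :
    gaussSum (χ.ringHomComp φ) ψ ^ 4 = φ (l * star l * l ^ 2) := by
  have ho := primary_odd hl
  have hne := comp_sq_ne φ h2 hf hk hp ho hχ
  have h1 := jacobiSum_mul_nontrivial hne ψ
  rw [jacobiSum_ringHomComp, jacobi_eq hf hk hp hl hχ] at h1
  have hq : (χ.ringHomComp φ * χ.ringHomComp φ).IsQuadratic := by
    intro a
    simp only [MulChar.mul_apply, MulChar.ringHomComp_apply]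
    rcases (chi_val hf hp ho hχ a).cases with h | h | h | h | h <;> rw [h, ← map_mul] <;> simp [gi_mul_gi]
  have h3 := gaussSum_sq hne hq hψ
  have h6 := chi_neg_one hf hp ho hχ
  rw [MulChar.mul_apply, MulChar.ringHomComp_apply, ← map_mul, h6, map_one, one_mul, card_F hf hk] at h3
  have hN : ((l.norm.natAbs : ℕ) : K) = φ (l * star l) := by
    rw [← Zsqrtd.norm_eq_mul_conj, map_intCast]
    have : (l.norm.natAbs : ℤ) = l.norm := Int.natAbs_of_nonneg (norm_nn _)
    rw [← Int.cast_natCast (R := K), this]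
  rw [hN] at h3
  have h7 : φ (χ (-1)) * φ (χ (-1)) = 1 := by rw [← map_mul, h6, map_one]
  have h8 : gaussSum (χ.ringHomComp φ) ψ ^ 4 = (gaussSum (χ.ringHomComp φ) ψ * gaussSum (χ.ringHomComp φ) ψ) ^ 2 := by ring
  rw [h8, ← h1, mul_pow, h3]
  simp only [map_mul, map_neg, map_pow]
  linear_combination (φ l ^ 3 * φ (star l)) * h7

lemma card_K (hf : Function.Surjective f) (hk : ∀ x, f x = 0 ↔ l ∣ x) :
    (Fintype.card F : K) = φ (l * star l) := by
  rw [card_F hf hk, ← Zsqrtd.norm_eq_mul_conj, map_intCast]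
  have : (l.norm.natAbs : ℤ) = l.norm := Int.natAbs_of_nonneg (norm_nn _)
  rw [← Int.cast_natCast (R := K), this]

lemma gauss_ne (h2 : (2 : K) ≠ 0) (hf : Function.Surjective f) (hk : ∀ x, f x = 0 ↔ l ∣ x) (hp : Prime l)
    (ho : GOdd l) (hχ : ∀ x, χ (f x) = quartic x l) {ψ : AddChar F K} (hψ : ψ.IsPrimitive)
    (hN : φ (l * star l) ≠ 0) : gaussSum (χ.ringHomComp φ) ψ ≠ 0 := by
  refine gaussSum_ne_zero_of_nontrivial (by rwa [card_K φ hf hk]) ?_ hψ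
  intro h
  have := comp_sq_ne φ h2 hf hk hp ho hχ
  rw [h] at this; exact this (one_mul _)

lemma comp_four (hf : Function.Surjective f) (hp : Prime l)
    (ho : GOdd l) (hχ : ∀ x, χ (f x) = quartic x l) : (χ.ringHomComp φ) ^ 4 = 1 := by
  rw [MulChar.ringHomComp_pow, chi_four hf hp ho hχ, MulChar.ringHomComp_one]

lemma gauss_one (p : ℕ) [Fact p.Prime] [CharP K p] (hp4 : p % 4 = 1) (h2 : (2 : K) ≠ 0)
    (hf : Function.Surjective f) (hk : ∀ x, f x = 0 ↔ l ∣ x) (hp : Prime l)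
    (hl : IsPrimary l) (hχ : ∀ x, χ (f x) = quartic x l) {ψ : AddChar F K} (hψ : ψ.IsPrimitive)
    (hN : φ (l * star l) ≠ 0) (hpF : (p : F) ≠ 0) :
    φ (χ p) * φ (l * star l * l ^ 2) ^ ((p - 1) / 4) = 1 := by
  have ho := primary_odd hl
  have h0 := gauss_ne φ h2 hf hk hp ho hχ hψ hN
  have h1 := gaussSum_frob p (χ.ringHomComp φ) ψ
  have hpp : p = 4 * ((p - 1) / 4) + 1 := by omega
  have h3 : (χ.ringHomComp φ) ^ p = χ.ringHomComp φ := by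
    rw [hpp, pow_succ, pow_mul, comp_four φ hf hp ho hχ, one_pow, one_mul]
  have h4 := gaussSum_mulShift (χ.ringHomComp φ) ψ (Units.mk0 (p : F) hpF)
  rw [Units.val_mk0, ← AddChar.pow_mulShift, MulChar.ringHomComp_apply] at h4
  rw [h3] at h1
  rw [← h1] at h4
  rw [← gauss_four φ h2 hf hk hp hl hχ hψ, ← pow_mul]
  apply mul_right_cancel₀ h0
  rw [mul_assoc, ← pow_succ, ← hpp, h4, one_mul]

lemma gauss_three (p : ℕ) [Fact p.Prime] [CharP K p] (hp4 : p % 4 = 3) (h2 : (2 : K) ≠ 0)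
    (hf : Function.Surjective f) (hk : ∀ x, f x = 0 ↔ l ∣ x) (hp : Prime l)
    (hl : IsPrimary l) (hχ : ∀ x, χ (f x) = quartic x l) {ψ : AddChar F K} (hψ : ψ.IsPrimitive)
    (hpF : (p : F) ≠ 0) :
    φ (l * star l * l ^ 2) ^ ((p + 1) / 4) = φ (χ (-p)) * φ (l * star l) := by
  have ho := primary_odd hl
  have h1 := gaussSum_frob p (χ.ringHomComp φ) ψ
  have h44 := comp_four φ hf hp ho hχ
  have hpp : p = 4 * ((p - 3) / 4) + 3 := by omega
  have hpp2 : p + 1 = 4 * ((p + 1) / 4) := by omega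
  have h3 : (χ.ringHomComp φ) ^ p = (χ.ringHomComp φ) ^ 3 := by
    rw [hpp, pow_add, pow_mul, h44, one_pow, one_mul]
  have hne := comp_sq_ne φ h2 hf hk hp ho hχ
  have hord : orderOf (χ.ringHomComp φ) = 4 := by
    refine orderOf_eq_prime_pow (p := 2) (n := 1) ?_ ?_
    · simpa [pow_two] using hne
    · exact h44
  have hne1 : χ.ringHomComp φ ≠ 1 := by
    intro h; rw [h] at hne; exact hne (one_mul _)
  have h5 := gaussSum_mul_gaussSum_pow_orderOf_sub_one hne1 hψ
  rw [hord, card_K φ hf hk] at h5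
  have h4 := gaussSum_mulShift ((χ.ringHomComp φ) ^ 3) ψ (Units.mk0 (p : F) hpF)
  rw [Units.val_mk0, ← AddChar.pow_mulShift, MulChar.pow_apply' _ (by norm_num)] at h4
  rw [h3] at h1
  rw [← h1] at h4
  simp only [MulChar.ringHomComp_apply] at h4 h5
  change _ * gaussSum (χ.ringHomComp φ ^ 3) ψ = _ at h5
  rw [← h4] at h5
  rw [← gauss_four φ h2 hf hk hp hl hχ hψ, ← pow_mul, ← hpp2, pow_succ]
  have h6 : φ (χ p) ^ 4 = 1 := by
    rw [← map_pow, (chi_val hf hp ho hχ _).pow_four (chi_ne hpF), map_one]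
  rw [show (-(p : F)) = (-1) * p by ring, map_mul, map_mul]
  linear_combination φ (χ p) * h5 - gaussSum (χ.ringHomComp φ) ψ ^ p * gaussSum (χ.ringHomComp φ) ψ * h6

end Gauss

section Setup

lemma K_two {K : Type} [Field K] (f : ℤ[i] →+* K) {l : ℤ[i]} (hk : ∀ x, f x = 0 ↔ l ∣ x)
    (hp : Prime l) (ho : GOdd l) : (2 : K) ≠ 0 := by
  have := two_not_dvd hp ho
  rw [← hk, show (2 : ℤ[i]) = 1 + 1 by ext <;> simp, map_add, map_one] at this
  rwa [one_add_one_eq_two] at this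
variable {l π : ℤ[i]}

lemma star_prime_dvd (hp : Prime π) (p : ℕ) (hd : π ∣ (p : ℤ[i])) (hπ : ¬ π ∣ l) (h : ¬ star π ∣ l) :
    ¬ π ∣ l * star l := by
  intro h'
  rcases hp.dvd_or_dvd h' with h1 | h1
  · exact hπ h1
  · exact h (by simpa using star_dvd h1)

/-- the field and character package -/
lemma package (p : ℕ) [hpf : Fact p.Prime] (hp : Prime π) (ho : GOdd π) (hd : π ∣ (p : ℤ[i]))
    (hl : Prime l) (hlp : IsPrimary l) (hnd : ¬ l ∣ (p : ℤ[i])) :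
    (p % 4 = 1 → ¬ π ∣ l * star l → π ∣ quartic p l * (l * star l * l ^ 2) ^ ((p - 1) / 4) - 1) ∧
    (p % 4 = 3 → π ∣ (l * star l * l ^ 2) ^ ((p + 1) / 4) - quartic (-p) l * (l * star l)) := by
  have hol := primary_odd hlp
  haveI := isField_quot hp
  haveI := isField_quot hl
  letI : Field (ℤ[i] ⧸ Ideal.span {π}) := Ideal.Quotient.field (Ideal.span {π})
  letI : Field (ℤ[i] ⧸ Ideal.span {l}) := Ideal.Quotient.field (Ideal.span {l})
  haveI := finite_quot hp.ne_zero
  haveI := finite_quot hl.ne_zero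
  letI := Fintype.ofFinite (ℤ[i] ⧸ Ideal.span {l})
  let f : ℤ[i] →+* (ℤ[i] ⧸ Ideal.span {l}) := Ideal.Quotient.mk _
  have hf : Function.Surjective f := Ideal.Quotient.mk_surjective
  have hk : ∀ x, f x = 0 ↔ l ∣ x := mk_eq_zero_iff
  obtain ⟨χ, hχ⟩ := exists_chi hf hk hl hol
  have hpF : (p : ℤ[i] ⧸ Ideal.span {l}) ≠ 0 := by
    rw [← hk, map_natCast] at hnd; exact hnd
  have hpK : (p : ℤ[i] ⧸ Ideal.span {π}) = 0 := by
    rw [← mk_eq_zero_iff, map_natCast] at hd; exact hd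
  have hc : CharP (ℤ[i] ⧸ Ideal.span {π}) p := by
    have h1 := CharP.ringChar_of_prime_eq_zero hpf.1 hpK
    rw [← h1]; exact ringChar.charP _
  have hr : ringChar (ℤ[i] ⧸ Ideal.span {π}) ≠ ringChar (ℤ[i] ⧸ Ideal.span {l}) := by
    intro h
    rw [CharP.ringChar_of_prime_eq_zero hpf.1 hpK] at h
    apply hpF
    rw [h]; exact ringChar.Nat.cast_ringChar
  let ψ := AddChar.FiniteField.primitiveChar (ℤ[i] ⧸ Ideal.span {l}) (ℤ[i] ⧸ Ideal.span {π}) hr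
  let K := CyclotomicField ψ.n (ℤ[i] ⧸ Ideal.span {π})
  let a : (ℤ[i] ⧸ Ideal.span {π}) →+* K := algebraMap _ _
  let φ : ℤ[i] →+* K := a.comp (Ideal.Quotient.mk _)
  have hφ : ∀ x, φ x = 0 ↔ π ∣ x := by
    intro x
    rw [← mk_eq_zero_iff]
    exact map_eq_zero a
  haveI : CharP K p := charP_of_injective_algebraMap a.injective p
  have h2 : (2 : K) ≠ 0 := K_two φ hφ hp ho
  have hcp : χ (p : ℤ[i] ⧸ Ideal.span {l}) = quartic p l := by
    rw [← hχ, show f (p : ℤ[i]) = (p : _) from map_natCast f p]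
  have hcn : χ (-p : ℤ[i] ⧸ Ideal.span {l}) = quartic (-p) l := by
    rw [← hχ, map_neg f, show f (p : ℤ[i]) = (p : _) from map_natCast f p]
  constructor
  · intro h4 hN
    rw [← hφ] at hN
    have := gauss_one φ p h4 h2 hf hk hl hlp hχ ψ.prim hN hpF
    rw [← hφ, map_sub, map_mul, map_pow, map_one, ← hcp, this, sub_self]
  · intro h4
    have := gauss_three φ p h4 h2 hf hk hl hlp hχ ψ.prim hpF
    rw [← hφ, map_sub, map_pow, this, map_mul φ (quartic _ _), hcn, sub_self]
end Setup

lemma prime_of_norm {π : ℤ[i]} {p : ℕ} (hp : p.Prime) (h : π.norm = p) : Prime π := by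
  rw [← irreducible_iff_prime]
  constructor
  · intro hu
    have := (Zsqrtd.norm_eq_one_iff' (by norm_num) π).2 hu
    rw [h] at this
    exact hp.one_lt.ne' (by exact_mod_cast this)
  · intro a b hab
    have h1 : a.norm.natAbs * b.norm.natAbs = p := by
      rw [← Int.natAbs_mul, ← Zsqrtd.norm_mul, ← hab, h]; simp
    rcases (Nat.prime_mul_iff.1 (h1 ▸ hp)) with ⟨_, h3⟩ | ⟨_, h3⟩
    · right; exact Zsqrtd.norm_eq_one_iff.1 h3
    · left; exact Zsqrtd.norm_eq_one_iff.1 h3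

lemma split_prime (p : ℕ) [hp : Fact p.Prime] (h4 : p % 4 = 1) :
    ∃ π : ℤ[i], Prime π ∧ GOdd π ∧ (p : ℤ[i]) = π * star π ∧ qe π = (p - 1) / 4 := by
  obtain ⟨a, b, hab⟩ := Nat.Prime.sq_add_sq (p := p) (by omega)
  have hn : (⟨a, b⟩ : ℤ[i]).norm = p := by rw [norm_eq', ← hab]; push_cast; rfl
  refine ⟨⟨a, b⟩, prime_of_norm hp.1 hn, ?_, ?_, ?_⟩
  · unfold GOdd; rw [hn]; rw [Int.odd_iff]; omega
  · rw [← Zsqrtd.norm_eq_mul_conj, hn]; simp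
  · unfold qe; rw [hn]; simp

lemma prime_three (p : ℕ) [hp : Fact p.Prime] (h4 : p % 4 = 3) :
    Prime (p : ℤ[i]) ∧ GOdd (p : ℤ[i]) ∧ qe (p : ℤ[i]) = (p * p - 1) / 4 := by
  refine ⟨GaussianInt.prime_of_nat_prime_of_mod_four_eq_three p h4, GOdd.nat ?_, ?_⟩
  · rw [Nat.odd_iff]; omega
  · unfold qe; rw [Zsqrtd.norm_natCast, Int.natAbs_mul]; simp

lemma not_dvd_of_cop {x y z : ℤ[i]} (hp : Prime x) (hd : x ∣ y) (h : IsCoprime y z) : ¬ x ∣ z :=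
  fun h' => hp.not_isUnit (h.isUnit_of_dvd' hd h')

lemma rat_one (p : ℕ) [hp : Fact p.Prime] (h4 : p % 4 = 1) {l : ℤ[i]} (hl : Prime l)
    (hlp : IsPrimary l) (hc : IsCoprime (p : ℤ[i]) l) : quarticGen p l = quarticGen l p := by
  obtain ⟨π, h1, h2, h3, h5⟩ := split_prime p h4
  have hd : π ∣ p := ⟨_, h3⟩
  have hd' : star π ∣ p := ⟨π, by rw [h3, mul_comm]⟩
  have hol := primary_odd hlp
  have h6 := not_dvd_of_cop h1 hd hc
  have h7 := not_dvd_of_cop h1.gstar hd' hc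
  have h8 : ¬ π ∣ l * star l := star_prime_dvd h1 p hd h6 h7
  have h9 := (package p h1 h2 hd hl hlp (not_dvd_of_cop hl dvd_rfl hc.symm)).1 h4 h8
  rw [← h5] at h9
  have h10 := (quartic_spec h1 h2 (l * star l * l ^ 2))
  have h11 : quartic p l * quartic (l * star l * l ^ 2) π = 1 := by
    refine IsVal.eq_of_dvd h1 h2 ((quartic_spec hl hol _).2.mul h10.2) IsVal.one ?_
    have := dvd_sub h9 (h10.1.mul_left (quartic p l))
    convert this using 1; ring
  have h12 : quartic (star l) π = star (quartic l (star π)) := by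
    rw [← quartic_star h1.gstar h2.star, star_star]
  rw [pow_two, quartic_mul h1 h2, quartic_mul h1 h2, quartic_mul h1 h2, h12] at h11
  have hy := (quartic_spec h1 h2 l).2.pow_four (by rwa [Ne, quartic_eq_zero_iff h1 h2])
  have hz := (quartic_spec h1.gstar h2.star l).2.mul_star
    (by rwa [Ne, quartic_eq_zero_iff h1.gstar h2.star])
  rw [S_prime hl hol, h3, S_mul_right h2 h2.star, S_prime h1 h2, S_prime h1.gstar h2.star, ← h3]
  generalize quartic p l = x at *
  generalize quartic l π = y at *
  generalize quartic l (star π) = z at *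
  generalize star z = w at *
  linear_combination (y * z) * h11 - x * z * w * hy - x * hz

lemma frob_star (p : ℕ) [hp : Fact p.Prime] (h4 : p % 4 = 3) (l : ℤ[i]) :
    (p : ℤ[i]) ∣ star l - l ^ p := by
  have key : ∀ a : ℤ, (p : ℤ[i]) ∣ (a : ℤ[i]) ^ p - a := by
    intro a
    have : (p : ℤ) ∣ a ^ p - a := by
      rw [← ZMod.intCast_zmod_eq_zero_iff_dvd]; push_cast; rw [ZMod.pow_card]; ring
    have := (Zsqrtd.intCast_dvd_intCast (d := -1) _ _).2 this
    exact_mod_cast this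
  have e1 : l = (l.re : ℤ[i]) + (l.im : ℤ[i]) * gi := by ext <;> simp
  have e2 : star l = (l.re : ℤ[i]) - (l.im : ℤ[i]) * gi := by ext <;> simp
  obtain ⟨r, hr⟩ := exists_add_pow_prime_eq hp.1 (l.re : ℤ[i]) ((l.im : ℤ[i]) * gi)
  have hg : gi ^ p = - gi := by
    rw [← Nat.div_add_mod p 4, h4, pow_add, pow_mul, gi_pow_four, one_pow, one_mul, pow_succ, gi_sq]; ring
  rw [mul_pow, hg] at hr
  obtain ⟨s, hs⟩ := key l.re
  obtain ⟨t, ht⟩ := key l.im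
  have e3 : l ^ p = (l.re : ℤ[i]) ^ p + (l.im : ℤ[i]) ^ p * -gi + p * (l.re : ℤ[i]) * ((l.im : ℤ[i]) * gi) * r := by
    rw [← hr, ← e1]
  rw [e3, e2]
  refine ⟨-s + t * gi - (l.re : ℤ[i]) * ((l.im : ℤ[i]) * gi) * r, ?_⟩
  linear_combination -hs + gi * ht

lemma rat_three (p : ℕ) [hp : Fact p.Prime] (h4 : p % 4 = 3) {l : ℤ[i]} (hl : Prime l)
    (hlp : IsPrimary l) (hc : IsCoprime (p : ℤ[i]) l) : quarticGen (-p) l = quarticGen l p := by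
  obtain ⟨h1, h2, h5⟩ := prime_three p h4
  have hol := primary_odd hlp
  have h6 := not_dvd_of_cop h1 dvd_rfl hc
  have h9 := (package p h1 h2 dvd_rfl hl hlp (not_dvd_of_cop hl dvd_rfl hc.symm)).2 h4
  rw [S_prime hl hol, S_prime h1 h2]
  symm
  refine quartic_unique h1 h2 (quartic_spec hl hol _).2 ?_
  have hf := frob_star p h4 l
  rw [← mk_eq_iff] at hf h9 ⊢
  have h7 : Ideal.Quotient.mk (Ideal.span {(p : ℤ[i])}) l ≠ 0 := by
    rw [Ne, mk_eq_zero_iff]; exact h6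
  haveI := isField_quot h1
  letI : Field (ℤ[i] ⧸ Ideal.span {(p : ℤ[i])}) := Ideal.Quotient.field _
  simp only [map_pow, map_mul] at h9 hf ⊢
  rw [hf] at h9
  generalize Ideal.Quotient.mk (Ideal.span {(p : ℤ[i])}) l = x at *
  generalize Ideal.Quotient.mk (Ideal.span {(p : ℤ[i])}) (quartic (-p) l) = c at *
  have e : qe (p : ℤ[i]) + (p + 1) = (p + 3) * ((p + 1) / 4) := by
    rw [h5]
    obtain ⟨k, hk⟩ : ∃ k, p = 4 * k + 3 := ⟨p / 4, by omega⟩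
    rw [hk, show (4 * k + 3 + 1) / 4 = k + 1 by omega,
      show ((4 * k + 3) * (4 * k + 3) - 1) = 4 * (4 * k * k + 6 * k + 2) by
        rw [Nat.sub_eq_iff_eq_add (by nlinarith)]; ring]
    rw [Nat.mul_div_cancel_left _ (by norm_num)]; ring
  apply mul_right_cancel₀ (pow_ne_zero (p + 1) h7)
  rw [← pow_add, e, pow_mul]
  calc _ = (x * x ^ p * x ^ 2) ^ ((p + 1) / 4) := by congr 1; ring
    _ = _ := by rw [h9]; ring

/-- sign making an odd integer congruent to one mod four -/
def sgn (n : ℤ) : ℤ := if n % 4 = 1 then 1 else -1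

lemma sgn_mul {a b : ℤ} (ha : Odd a) (hb : Odd b) : sgn (a * b) = sgn a * sgn b := by
  unfold sgn
  rw [Int.odd_iff] at ha hb
  have h1 : a % 4 = 1 ∨ a % 4 = 3 := by omega
  have h2 : b % 4 = 1 ∨ b % 4 = 3 := by omega
  rcases h1 with h1 | h1 <;> rcases h2 with h2 | h2 <;> simp [Int.mul_emod, h1, h2]

lemma sgn_neg {a : ℤ} (ha : Odd a) : sgn (-a) = - sgn a := by
  unfold sgn
  rw [Int.odd_iff] at ha
  split_ifs <;> omega

lemma sgn_sq (a : ℤ) : sgn a * sgn a = 1 := by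
  unfold sgn; split_ifs <;> rfl

lemma odd_int_induction {Q : ℤ → Prop} (h1 : Q 1) (hn : ∀ n, Odd n → Q n → Q (-n))
    (hp : ∀ p : ℕ, p.Prime → p % 2 = 1 → Q p)
    (hm : ∀ a b, Odd a → Odd b → Q a → Q b → Q (a * b)) : ∀ n, Odd n → Q n := by
  have key : ∀ n : ℕ, Odd (n : ℤ) → Q n := by
    intro n
    induction n using induction_on_primes with
    | zero => intro h; simp at h
    | one => intro _; simpa using h1
    | prime_mul p a hpp ih =>
      intro h
      push_cast at h ⊢
      have h3 := Int.odd_mul.1 h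
      refine hm _ _ h3.1 h3.2 (hp p hpp ?_) (ih h3.2)
      have := Int.odd_iff.1 h3.1; omega
  intro n ho
  rcases Int.natAbs_eq n with h | h
  · rw [h] at ho ⊢; exact key _ ho
  · rw [h] at ho ⊢
    have := ho.neg
    rw [neg_neg] at this
    exact hn _ this (key _ this)

lemma rat_int {l : ℤ[i]} (hl : Prime l) (hlp : IsPrimary l) : ∀ n : ℤ, Odd n →
    IsCoprime (n : ℤ[i]) l → quarticGen ((sgn n * n : ℤ) : ℤ[i]) l = quarticGen l n := by
  have hol := primary_odd hlp
  refine odd_int_induction ?_ ?_ ?_ ?_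
  · intro _
    rw [show (sgn 1 * 1 : ℤ) = 1 from rfl, Int.cast_one, S_one hol, S_unit isUnit_one]
  · intro n ho h hc
    rw [sgn_neg ho, neg_mul_neg, h (by push_cast at hc; exact (IsCoprime.neg_left_iff _ _).1 hc)]
    push_cast
    exact S_assoc (GOdd.int ho) (Associated.refl _).neg_right _
  · intro p hp h2 hc
    haveI : Fact p.Prime := ⟨hp⟩
    rw [Int.cast_natCast] at hc ⊢
    have h3 : p % 4 = 1 ∨ p % 4 = 3 := by omega
    rcases h3 with h3 | h3
    · rw [show sgn p = 1 by unfold sgn; rw [if_pos]; omega]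
      simpa using rat_one p h3 hl hlp hc
    · rw [show sgn p = -1 by unfold sgn; rw [if_neg]; omega]
      simpa using rat_three p h3 hl hlp hc
  · intro a b ha hb h1 h2 hc
    rw [Int.cast_mul] at hc
    have e : sgn (a * b) * (a * b) = (sgn a * a) * (sgn b * b) := by rw [sgn_mul ha hb]; ring
    rw [e, Int.cast_mul, S_mul_left hol, h1 hc.of_mul_left_left, h2 hc.of_mul_left_right,
      Int.cast_mul, S_mul_right (GOdd.int ha) (GOdd.int hb)]

lemma rat_rat (d : ℤ) : ∀ c : ℤ, Odd c → IsCoprime (c : ℤ[i]) d →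
    quarticGen (d : ℤ[i]) c = 1 := by
  refine odd_int_induction ?_ ?_ ?_ ?_
  · intro _
    rw [Int.cast_one, S_unit isUnit_one]
  · intro n ho h hc
    rw [← h (by push_cast at hc; exact (IsCoprime.neg_left_iff _ _).1 hc)]
    push_cast
    exact (S_assoc (GOdd.int ho) (Associated.refl _).neg_right _).symm
  · intro p hp h2 hc
    haveI : Fact p.Prime := ⟨hp⟩
    rw [Int.cast_natCast] at hc ⊢
    have h3 : p % 4 = 1 ∨ p % 4 = 3 := by omega
    rcases h3 with h3 | h3
    · obtain ⟨π, h1, h2, h4, h5⟩ := split_prime p h3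
      have hd : π ∣ p := ⟨_, h4⟩
      have h6 := not_dvd_of_cop h1 hd hc
      rw [h4, S_mul_right h2 h2.star, S_prime h1 h2, S_prime h1.gstar h2.star]
      have := quartic_star h1 h2 d
      rw [show star (d : ℤ[i]) = d by ext <;> simp] at this
      rw [this]
      exact (quartic_spec h1 h2 d).2.mul_star (by rwa [Ne, quartic_eq_zero_iff h1 h2])
    · obtain ⟨h1, h2, h5⟩ := prime_three p h3
      have h6 := not_dvd_of_cop h1 dvd_rfl hc
      rw [S_prime h1 h2]
      refine quartic_unique h1 h2 IsVal.one ?_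
      have h7 : IsCoprime d p := by
        rw [isCoprime_comm, Prime.coprime_iff_not_dvd (Nat.prime_iff_prime_int.1 hp)]
        intro h
        apply h6
        have := (Zsqrtd.intCast_dvd_intCast (d := -1) _ _).2 h
        exact_mod_cast this
      have h8 := (Int.ModEq.pow_card_sub_one_eq_one hp h7).pow ((p + 1) / 4)
      rw [one_pow, ← pow_mul] at h8
      have e : qe (p : ℤ[i]) = (p - 1) * ((p + 1) / 4) := by
        rw [h5]
        obtain ⟨k, hk⟩ : ∃ k, p = 4 * k + 3 := ⟨p / 4, by omega⟩
        rw [hk, show (4 * k + 3 + 1) / 4 = k + 1 by omega, show 4 * k + 3 - 1 = 4 * k + 2 by omega,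
          show ((4 * k + 3) * (4 * k + 3) - 1) = 4 * (4 * k * k + 6 * k + 2) by
            rw [Nat.sub_eq_iff_eq_add (by nlinarith)]; ring]
        rw [Nat.mul_div_cancel_left _ (by norm_num)]; ring
      rw [← e] at h8
      have := (Zsqrtd.intCast_dvd_intCast (d := -1) _ _).2 h8.symm.dvd
      exact_mod_cast this
  · intro a b ha hb h1 h2 hc
    rw [Int.cast_mul] at hc
    rw [Int.cast_mul, S_mul_right (GOdd.int ha) (GOdd.int hb), h1 hc.of_mul_left_left,
      h2 hc.of_mul_left_right, one_mul]

lemma primary_iff (z : ℤ[i]) : IsPrimary z ↔ z.im % 2 = 0 ∧ (z.re + z.im) % 4 = 1 := by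
  unfold IsPrimary
  constructor
  · rintro ⟨y, hy⟩
    have h1 := congrArg Zsqrtd.re hy
    have h2 := congrArg Zsqrtd.im hy
    simp at h1 h2
    omega
  · rintro ⟨h1, h2⟩
    refine ⟨⟨(z.re - 1 + z.im) / 4, z.im / 2 - (z.re - 1 + z.im) / 4⟩, ?_⟩
    ext
    · simp; omega
    · simp; omega

/-- value of the symbol of `i` modulo a rational integer -/
def gval (n : ℤ) : ℤ := if n % 8 = 1 ∨ n % 8 = 7 then 1 else -1
/-- value of the symbol of `-1` -/
def kval (d : ℤ) : ℤ := if d % 4 = 0 then 1 else -1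
/-- value of the symbol of a sign -/
def uval (u d : ℤ) : ℤ := if u = -1 then kval d else 1
/-- reciprocity sign -/
def eps (b d : ℤ) : ℤ := if b % 4 = 2 ∧ d % 4 = 2 then -1 else 1

lemma S_gi_int {n : ℤ} (ho : Odd n) : quarticGen gi (n : ℤ[i]) = (gval n : ℤ) := by
  rw [S_gi (GOdd.int ho)]
  have h4 := four_qe (GOdd.int ho)
  rw [Zsqrtd.norm_intCast] at h4
  have h5 : (4 * qe (n : ℤ[i]) + 1 : ℤ) = n * n := by
    have : ((n * n).natAbs : ℤ) = n * n := Int.natAbs_of_nonneg (mul_self_nonneg n)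
    omega
  generalize qe (n : ℤ[i]) = q at *
  obtain ⟨k, hk⟩ : ∃ k, n = 8 * k + n % 8 := ⟨n / 8, by omega⟩
  have ho' := Int.odd_iff.1 ho
  unfold gval
  have hc : n % 8 = 1 ∨ n % 8 = 7 ∨ n % 8 = 3 ∨ n % 8 = 5 := by omega
  have hq : (n % 8 = 1 ∨ n % 8 = 7) ∧ q % 4 = 0 ∨ (n % 8 = 3 ∨ n % 8 = 5) ∧ q % 4 = 2 := by
    rcases hc with h | h | h | h <;> rw [h] at hk ⊢ <;> rw [hk] at h5 <;> ring_nf at h5 <;> 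
      (generalize k ^ 2 = kk at h5; omega)
  rcases hq with ⟨h1, h2⟩ | ⟨h1, h2⟩
  · rw [if_pos h1, ← Nat.div_add_mod q 4, h2, pow_add, pow_mul, gi_pow_four]; simp
  · rw [if_neg (by omega), ← Nat.div_add_mod q 4, h2, pow_add, pow_mul, gi_pow_four, gi_sq]; simp

lemma S_neg_one_val {β : ℤ[i]} (hβ : IsPrimary β) : quarticGen (-1) β = (kval β.im : ℤ) := by
  have ho := primary_odd hβ
  rw [S_neg_one ho]
  have h4 := four_qe ho
  have h5 : (4 * qe β + 1 : ℤ) = β.re ^ 2 + β.im ^ 2 := by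
    have : (β.norm.natAbs : ℤ) = β.norm := Int.natAbs_of_nonneg (norm_nn β)
    rw [← norm_eq']; omega
  obtain ⟨h1, h2⟩ := (primary_iff β).1 hβ
  obtain ⟨y, hy⟩ : ∃ y, β.im = 2 * y := ⟨β.im / 2, by omega⟩
  obtain ⟨x, hx⟩ : ∃ x, β.re = 2 * x + 1 := ⟨β.re / 2, by omega⟩
  have hxx := Int.even_mul_succ_self x
  rw [hx, hy] at h5
  have h6 : (qe β : ℤ) = x * (x + 1) + y * y := by linarith
  unfold kval
  rw [hy]
  rcases Int.even_or_odd y with hyy | hyy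
  · rw [if_pos (by obtain ⟨t, rfl⟩ := hyy; omega)]
    have : Even (qe β) := by
      rw [← Int.even_coe_nat, h6]; exact hxx.add (hyy.mul_right _)
    rw [this.neg_one_pow]; simp
  · rw [if_neg (by obtain ⟨t, rfl⟩ := hyy; omega)]
    have : Odd (qe β) := by
      rw [← Int.odd_coe_nat, h6]; exact hxx.add_odd (hyy.mul hyy)
    rw [this.neg_one_pow]; simp

lemma sgn_cases (a : ℤ) : sgn a = 1 ∨ sgn a = -1 := by
  unfold sgn; split_ifs <;> simp

lemma S_u {β : ℤ[i]} (hβ : IsPrimary β) {u : ℤ} (hu : u = 1 ∨ u = -1) :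
    quarticGen (u : ℤ[i]) β = (uval u β.im : ℤ) := by
  unfold uval
  rcases hu with rfl | rfl
  · rw [if_neg (by norm_num)]; simpa using S_one (primary_odd hβ)
  · rw [if_pos rfl, ← S_neg_one_val hβ]; simp

set_option maxHeartbeats 2000000 in
lemma sign_identity {a b c d : ℤ} (hb : b % 2 = 0) (hd : d % 2 = 0) (ha : (a + b) % 4 = 1)
    (hc : (c + d) % 4 = 1) :
    gval c * uval (sgn c * sgn (a * c + b * d)) d =
    eps b d * (gval (a * c + b * d) * gval a * uval (sgn a * sgn (a * c + b * d)) b) := by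
  have hm : (a * c + b * d) % 8 = ((a % 8) * (c % 8) + (b % 8) * (d % 8)) % 8 := by
    rw [Int.add_emod, Int.mul_emod, Int.mul_emod b d, ← Int.add_emod]
  generalize a * c + b * d = m at *
  have h4 : ∀ x : ℤ, x % 4 = (x % 8) % 4 := fun x => by omega
  unfold gval uval sgn eps kval
  rw [h4 a, h4 b, h4 c, h4 d, h4 m, hm]
  have hb' : b % 8 = 0 ∨ b % 8 = 2 ∨ b % 8 = 4 ∨ b % 8 = 6 := by omega
  have hd' : d % 8 = 0 ∨ d % 8 = 2 ∨ d % 8 = 4 ∨ d % 8 = 6 := by omega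
  have ha' : a % 8 = 1 ∨ a % 8 = 3 ∨ a % 8 = 5 ∨ a % 8 = 7 := by omega
  have hc' : c % 8 = 1 ∨ c % 8 = 3 ∨ c % 8 = 5 ∨ c % 8 = 7 := by omega
  have ha2 : (a % 8 + b % 8) % 4 = 1 := by omega
  have hc2 : (c % 8 + d % 8) % 4 = 1 := by omega
  generalize a % 8 = a at *
  generalize b % 8 = b at *
  generalize c % 8 = c at *
  generalize d % 8 = d at *
  clear hm ha hb hc hd h4
  rcases ha' with rfl | rfl | rfl | rfl <;> rcases hb' with rfl | rfl | rfl | rfl <;>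
    first
    | (exfalso; revert ha2; decide)
    | (rcases hc' with rfl | rfl | rfl | rfl <;> rcases hd' with rfl | rfl | rfl | rfl <;>
        first
        | (exfalso; revert hc2; decide)
        | decide)

lemma eps_sq (b d : ℤ) : eps b d * eps b d = 1 := by unfold eps; split_ifs <;> rfl
lemma gval_sq (b : ℤ) : gval b * gval b = 1 := by unfold gval; split_ifs <;> rfl
lemma uval_sq (b d : ℤ) : uval b d * uval b d = 1 := by unfold uval kval; split_ifs <;> rfl

lemma cop_re {β : ℤ[i]} (hp : Prime β) (ho : Odd β.re) (him : β.im ≠ 0) :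
    IsCoprime (β.re : ℤ[i]) β := by
  rw [isCoprime_comm, hp.coprime_iff_not_dvd]
  rintro ⟨y, hy⟩
  have h1 := congrArg Zsqrtd.norm hy
  rw [Zsqrtd.norm_mul, Zsqrtd.norm_intCast, norm_eq' β] at h1
  have h2 : β.re ≠ 0 := by rintro h; rw [h] at ho; simp at ho
  have h3 : 0 < β.im ^ 2 := by positivity
  have h4 : 0 < β.re ^ 2 := by positivity
  have h5 := norm_nn y
  rcases h5.eq_or_lt with h6 | h6
  · rw [← h6] at h1; nlinarith
  · nlinarith

lemma S_self_re {β : ℤ[i]} (ho : Odd β.re) (hc : IsCoprime (β.re : ℤ[i]) β) :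
    quarticGen β (β.re : ℤ[i]) = (gval β.re : ℤ) := by
  have e : β = β.im * gi + β.re * 1 := by ext <;> simp
  have h1 : IsCoprime (β.re : ℤ[i]) (β.im * gi) := by
    nth_rewrite 2 [e] at hc
    exact hc.of_add_mul_left_right
  rw [S_congr (GOdd.int ho) (α' := β.im * gi) ⟨1, by linear_combination e⟩, S_mul_left (GOdd.int ho),
    rat_rat _ _ ho h1.of_mul_right_left, S_gi_int ho, one_mul]

/-- one half of the reduction -/
lemma half {α β : ℤ[i]} (hp : Prime β) (hβ : IsPrimary β) (ho : Odd β.re) (him : β.im ≠ 0)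
    (hc : IsCoprime α β) {m : ℤ} (hm : m = α.re * β.re + α.im * β.im) (hmo : Odd m) :
    IsCoprime (m : ℤ[i]) β ∧ (gval β.re : ℤ[i]) * quarticGen α β *
      (uval (sgn β.re * sgn m) β.im : ℤ) = quarticGen β m := by
  have hob := primary_odd hβ
  have h1 := cop_re hp ho him
  have e : (β.re : ℤ[i]) * α = m + β * (α.im * gi) := by
    rw [hm]; ext <;> simp <;> ring
  have h2 : IsCoprime (m : ℤ[i]) β := by
    have := h1.mul_left hc
    rw [e] at this
    exact this.of_add_mul_left_left
  refine ⟨h2, ?_⟩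
  have h3 : quarticGen (β.re : ℤ[i]) β * quarticGen α β = quarticGen (m : ℤ[i]) β := by
    rw [← S_mul_left hob]
    exact S_congr hob ⟨α.im * gi, by linear_combination e⟩
  have h4 := rat_int hp hβ _ ho h1
  have h5 := rat_int hp hβ _ hmo h2
  rw [S_self_re ho h1] at h4
  rw [Int.cast_mul, S_mul_left hob] at h4 h5
  have h6 := S_u hβ (u := sgn β.re * sgn m)
    (by rcases sgn_cases β.re with h | h <;> rcases sgn_cases m with h' | h' <;> rw [h, h'] <;> simp)
  rw [Int.cast_mul, S_mul_left hob] at h6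
  have h7 : quarticGen (sgn β.re : ℤ[i]) β * quarticGen (sgn β.re : ℤ[i]) β = 1 := by
    rw [← S_mul_left hob, ← Int.cast_mul, sgn_sq, Int.cast_one, S_one hob]
  rw [← h4, ← h5, ← h6, ← h3]
  linear_combination quarticGen (β.re : ℤ[i]) β * quarticGen α β * quarticGen (sgn m : ℤ[i]) β * h7

lemma prime_recip {α β : ℤ[i]} (hα : Prime α) (hβ : Prime β) (hα' : IsPrimary α)
    (hβ' : IsPrimary β) (hc : IsCoprime α β) :
    quarticGen β α = (eps α.im β.im : ℤ) * quarticGen α β := by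
  have ha := (primary_iff α).1 hα'
  have hb := (primary_iff β).1 hβ'
  have hoa : Odd α.re := by rw [Int.odd_iff]; omega
  have hob : Odd β.re := by rw [Int.odd_iff]; omega
  by_cases hb0 : β.im = 0
  · have e : β = (β.re : ℤ[i]) := by ext <;> simp [hb0]
    have := rat_int hα hα' β.re hob (by rw [← e]; exact hc.symm)
    rw [show sgn β.re = 1 by unfold sgn; rw [if_pos]; omega, one_mul, ← e] at this
    rw [this]; simp [eps, hb0]
  by_cases ha0 : α.im = 0
  · have e : α = (α.re : ℤ[i]) := by ext <;> simp [ha0]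
    have := rat_int hβ hβ' α.re hoa (by rw [← e]; exact hc)
    rw [show sgn α.re = 1 by unfold sgn; rw [if_pos]; omega, one_mul, ← e] at this
    rw [this]; simp [eps, ha0]
  obtain ⟨m, hm⟩ : ∃ m, m = α.re * β.re + α.im * β.im := ⟨_, rfl⟩
  have hmo : Odd m := by
    rw [hm]; exact (hoa.mul hob).add_even ((Int.even_iff.2 ha.1).mul_right _)
  obtain ⟨h1, h2⟩ := half hβ hβ' hob hb0 hc hm hmo
  obtain ⟨h3, h4⟩ := half hα hα' hoa ha0 hc.symm (m := m) (by rw [hm]; ring) hmo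
  have hM := GOdd.int hmo
  have hsm : star (m : ℤ[i]) = m := by ext <;> simp
  have h5 : IsCoprime (m : ℤ[i]) (star α) := by
    have := h3.map (starRingEnd ℤ[i])
    simpa [starRingEnd_apply, hsm] using this
  obtain ⟨n, hn⟩ : ∃ n, n = α.re * β.im - α.im * β.re := ⟨_, rfl⟩
  have e : β * star α = n * gi + m * 1 := by
    rw [hn, hm]; ext <;> simp <;> ring
  have h6 : IsCoprime (m : ℤ[i]) (n * gi) := by
    have := h1.mul_right h5
    rw [e] at this
    exact this.of_add_mul_left_right
  have h7 : quarticGen β m * quarticGen (star α) m = (gval m : ℤ) := by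
    rw [← S_mul_left hM, S_congr hM (α' := n * gi) ⟨1, by linear_combination e⟩, S_mul_left hM,
      rat_rat _ _ hmo h6.of_mul_right_left, S_gi_int hmo, one_mul]
  have h8 : quarticGen α m * quarticGen (star α) m = 1 := by
    have := S_star hM α
    rw [hsm] at this
    rw [this]
    exact (S_val hM _).mul_star (S_ne_zero hM h3.symm)
  have h9 : quarticGen β m = (gval m : ℤ) * quarticGen α m := by
    linear_combination quarticGen α m * h7 - quarticGen β m * h8
  rw [← h2, ← h4] at h9
  have h10 := sign_identity ha.1 hb.1 ha.2 hb.2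
  rw [← hm] at h10
  have h11 := congrArg (Int.cast : ℤ → ℤ[i]) h10
  have k1 := congrArg (Int.cast : ℤ → ℤ[i]) (eps_sq α.im β.im)
  have k2 := congrArg (Int.cast : ℤ → ℤ[i]) (gval_sq m)
  have k3 := congrArg (Int.cast : ℤ → ℤ[i]) (gval_sq α.re)
  have k4 := congrArg (Int.cast : ℤ → ℤ[i]) (uval_sq (sgn α.re * sgn m) α.im)
  push_cast at h11 k1 k2 k3 k4
  generalize ((gval m : ℤ) : ℤ[i]) = x at *
  generalize ((gval α.re : ℤ) : ℤ[i]) = y at *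
  generalize ((uval (sgn α.re * sgn m) α.im : ℤ) : ℤ[i]) = z at *
  generalize ((eps α.im β.im : ℤ) : ℤ[i]) = w at *
  have h12 : (x * y * z) * (w * quarticGen α β) = (x * y * z) * quarticGen β α := by
    linear_combination h9 - quarticGen α β * h11
  have h13 : (x * y * z) * (x * y * z) = 1 := by
    linear_combination y * y * z * z * k2 + z * z * k3 + k4
  linear_combination - (x * y * z) * h12 + (w * quarticGen α β - quarticGen β α) * h13

lemma IsPrimary.mul {x y : ℤ[i]} (hx : IsPrimary x) (hy : IsPrimary y) : IsPrimary (x * y) := by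
  unfold IsPrimary at *
  have := dvd_add (hx.mul_right y) hy
  convert this using 1; ring

lemma IsPrimary.one : IsPrimary 1 := by unfold IsPrimary; simp

lemma primary_assoc {x y : ℤ[i]} (hx : IsPrimary x) (hy : IsPrimary y) (h : Associated x y) : x = y := by
  obtain ⟨u, rfl⟩ := h
  have hn : (u : ℤ[i]).norm = 1 := (Zsqrtd.norm_eq_one_iff' (by norm_num) _).2 u.isUnit
  unfold IsPrimary at hx hy
  have := primary_unit hn (by
    have := dvd_sub hy (hx.mul_right (u : ℤ[i]))
    convert this using 1; ring)
  rw [this, mul_one]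

lemma isUnit_gi : IsUnit gi := ⟨⟨gi, -gi, by rw [mul_neg, gi_mul_gi]; simp, by rw [neg_mul, gi_mul_gi]; simp⟩, rfl⟩

lemma exists_primary {x : ℤ[i]} (h : GOdd x) : ∃ y, Associated x y ∧ IsPrimary y := by
  unfold GOdd at h
  rw [norm_eq', Int.odd_iff] at h
  have h2 : (x.re + x.im) % 2 = 1 := by
    have h3 := Int.even_mul_succ_self x.re
    have h4 := Int.even_mul_succ_self x.im
    rw [Int.even_iff] at h3 h4
    have e1 : x.re * (x.re + 1) = x.re ^ 2 + x.re := by ring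
    have e2 : x.im * (x.im + 1) = x.im ^ 2 + x.im := by ring
    omega
  have g : Associated x (x * gi) := associated_mul_unit_right x gi isUnit_gi
  by_cases h0 : x.im % 2 = 0
  · by_cases h1 : (x.re + x.im) % 4 = 1
    · exact ⟨x, Associated.refl _, (primary_iff _).2 ⟨h0, h1⟩⟩
    · exact ⟨-x, (Associated.refl _).neg_right, (primary_iff _).2 (by simp; omega)⟩
  · by_cases h1 : (x.re - x.im) % 4 = 1
    · exact ⟨x * gi, g, (primary_iff _).2 (by simp; omega)⟩
    · exact ⟨-(x * gi), g.neg_right, (primary_iff _).2 (by simp; omega)⟩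

lemma primary_induction {Q : ℤ[i] → Prop} (h1 : Q 1) (hp : ∀ p, Prime p → IsPrimary p → Q p)
    (hm : ∀ a b, IsPrimary a → IsPrimary b → Q a → Q b → Q (a * b)) : ∀ x, IsPrimary x → Q x := by
  have key : ∀ x, GOdd x → ∀ y, Associated x y → IsPrimary y → Q y := by
    refine odd_induction ?_ ?_ ?_
    · intro u hu y hy hy'
      rw [primary_assoc hy' IsPrimary.one (hy.symm.trans (associated_one_iff_isUnit.2 hu))]
      exact h1
    · intro p hpp _ y hy hy'
      exact hp y (hy.prime hpp) hy'
    · intro p x h2 h3 h4 h5 y hy hy'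
      obtain ⟨p', e1, e2⟩ := exists_primary h2
      obtain ⟨x', e3, e4⟩ := exists_primary h3
      rw [primary_assoc hy' (e2.mul e4) (hy.symm.trans (e1.mul_mul e3))]
      exact hm _ _ e2 e4 (h4 _ e1 e2) (h5 _ e3 e4)
  intro x hx
  exact key x (primary_odd hx) x (Associated.refl _) hx

lemma eps_comm (b d : ℤ) : eps b d = eps d b := by unfold eps; simp only [and_comm]

lemma eps_mul {x y : ℤ[i]} (hx : IsPrimary x) (hy : IsPrimary y) {d : ℤ} (hd : d % 2 = 0) :
    eps (x * y).im d = eps x.im d * eps y.im d := by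
  rw [primary_iff] at hx hy
  have : (x * y).im % 4 = (x.im + y.im) % 4 := by
    obtain ⟨b, hb⟩ : ∃ b, x.im = 2 * b := ⟨x.im / 2, by omega⟩
    obtain ⟨b', hb'⟩ : ∃ b, y.im = 2 * b := ⟨y.im / 2, by omega⟩
    obtain ⟨a, ha⟩ : ∃ a, x.re = 2 * a + 1 := ⟨x.re / 2, by omega⟩
    obtain ⟨a', ha'⟩ : ∃ a, y.re = 2 * a + 1 := ⟨y.re / 2, by omega⟩
    have e : (x * y).im = (x.im + y.im) + 4 * (a * b' + a' * b) := by
      rw [Zsqrtd.im_mul, hb, hb', ha, ha']; ring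
    rw [e]; omega
  unfold eps
  rw [this]
  split_ifs <;> omega

lemma recip {α β : ℤ[i]} (hα : IsPrimary α) (hβ : IsPrimary β) (hc : IsCoprime α β) :
    quarticGen β α = (eps α.im β.im : ℤ) * quarticGen α β := by
  have step : ∀ β, IsPrimary β → Prime β → ∀ α, IsPrimary α → (IsCoprime α β →
      quarticGen β α = (eps α.im β.im : ℤ) * quarticGen α β) := by
    intro β hβ hp
    refine primary_induction ?_ ?_ ?_
    · intro _; rw [S_unit isUnit_one, S_one (primary_odd hβ)]; simp [eps]
    · intro p h1 h2 h3; exact prime_recip h1 hp h2 hβ h3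
    · intro a b ha hb h1 h2 h3
      rw [S_mul_right (primary_odd ha) (primary_odd hb), S_mul_left (primary_odd hβ),
        eps_mul ha hb ((primary_iff β).1 hβ).1, h1 h3.of_mul_left_left, h2 h3.of_mul_left_right]
      push_cast; ring
  revert hc
  refine primary_induction (Q := fun β => IsCoprime α β →
    quarticGen β α = (eps α.im β.im : ℤ) * quarticGen α β) ?_ ?_ ?_ β hβ
  · intro _; rw [S_unit isUnit_one, S_one (primary_odd hα)]; simp [eps]
  · intro p h1 h2 h3; exact step p h2 h1 α hα h3
  · intro a b ha hb h1 h2 h3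
    rw [S_mul_right (primary_odd ha) (primary_odd hb), S_mul_left (primary_odd hα), eps_comm,
      eps_mul ha hb ((primary_iff α).1 hα).1, h1 h3.of_mul_right_left, h2 h3.of_mul_right_right,
      eps_comm, eps_comm b.im]
    push_cast; ring

lemma three_two_iff {x : ℤ[i]} (hx : IsPrimary x) : (4 : ℤ[i]) ∣ x - (3 + 2 * gi) ↔ x.im % 4 = 2 := by
  rw [primary_iff] at hx
  have : (4 : ℤ[i]) = ((4 : ℤ) : ℤ[i]) := by norm_num
  rw [this, Zsqrtd.intCast_dvd]
  simp
  omega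

/-- Quartic reciprocity, second form: `(β/α)₄ = -(α/β)₄` if both `α` and `β`
are `≡ 3 + 2i (mod 4)`, and `(β/α)₄ = (α/β)₄` otherwise. -/
theorem quartic_reciprocity' (α β : ℤ[i]) (hα : IsPrimary α) (hβ : IsPrimary β)
    (hαu : ¬ IsUnit α) (hβu : ¬ IsUnit β) (hcop : IsCoprime α β) :
    ((4 : ℤ[i]) ∣ α - (3 + 2 * gi) ∧ (4 : ℤ[i]) ∣ β - (3 + 2 * gi) →
      quarticGen β α = - quarticGen α β) ∧
    (¬ ((4 : ℤ[i]) ∣ α - (3 + 2 * gi) ∧ (4 : ℤ[i]) ∣ β - (3 + 2 * gi)) →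
      quarticGen β α = quarticGen α β) := by
  rw [three_two_iff hα, three_two_iff hβ]
  have h := recip hα hβ hcop
  unfold eps at h
  constructor
  · intro hh; rw [if_pos hh] at h; simpa using h
  · intro hh; rw [if_neg hh] at h; simpa using h
end

section
/- Let q ≡ 3 (mod 4) be a rational prime, d ∈ ℤ[i] fourth-power-free and coprime to q, and k = ℤ[i]/(q) ≅ 𝔽_{q²}. Then the number of k-points of the reduction of E_d : y² = x³ − dx equals q² + 1 if d is not a square in k; q² + 1 − 2q if d is a square but not a fourth power in k; and q² + 1 + 2q if d is a fourth power in k. -/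
open Zsqrtd

local notation "ℤ[i]" => GaussianInt

section helper
open Finset
variable {K : Type*} [Field K] [Fintype K] [DecidableEq K]

/-- the character sum -/
def SS (d : K) : ℤ := ∑ x : K, quadraticChar K (x ^ 3 - d * x)

lemma SS_mul_sq (d t : K) (ht : t ≠ 0) : SS (d * t ^ 2) = quadraticChar K t * SS d := by
  unfold SS
  rw [← Equiv.sum_comp (Equiv.mulLeft₀ t ht), Finset.mul_sum]
  refine Finset.sum_congr rfl fun x _ => ?_
  have h : (Equiv.mulLeft₀ t ht) x = t * x := rfl
  rw [h, show (t * x) ^ 3 - d * t ^ 2 * (t * x) = t * t ^ 2 * (x ^ 3 - d * x) by ring,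
    map_mul, map_mul, quadraticChar_sq_one' ht, mul_one]

lemma SS_nonsq (q : ℕ) [Fact q.Prime] [CharP K q] (h3 : q % 4 = 3) (d : K)
    (hd : ¬ IsSquare d) : SS d = 0 := by
  have hd0 : d ≠ 0 := by rintro rfl; exact hd (IsSquare.zero)
  have hχ : quadraticChar K d = -1 := quadraticChar_neg_one_iff_not_isSquare.mpr hd
  have hodd : Odd ((q - 1) / 2) := by rw [Nat.odd_iff]; omega
  have h1 : SS (d ^ q) = SS d := by
    unfold SS
    have hb : Function.Bijective (frobenius K q) :=
      Finite.injective_iff_bijective.mp (frobenius_inj K q)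
    rw [← Equiv.sum_comp (Equiv.ofBijective _ hb)]
    refine Finset.sum_congr rfl fun x _ => ?_
    have h : (Equiv.ofBijective _ hb) x = x ^ q := rfl
    rw [h, show (x ^ q) ^ 3 - d ^ q * x ^ q = (x ^ 3 - d * x) ^ q by
      rw [sub_pow_char, mul_pow]; ring, map_pow]
    rcases eq_or_ne (x ^ 3 - d * x) 0 with h0 | h0
    · rw [h0]; simp [(Fact.out : q.Prime).ne_zero]
    · have ho : Odd q := by rw [Nat.odd_iff]; omega
      rcases quadraticChar_dichotomy h0 with h | h <;> rw [h]
      · simp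
      · exact ho.neg_one_pow
  have h2 : d ^ q = d * (d ^ ((q - 1) / 2)) ^ 2 := by
    rw [← pow_mul, ← pow_succ']; congr 1; omega
  rw [h2, SS_mul_sq _ _ (pow_ne_zero _ hd0), map_pow, hχ, hodd.neg_one_pow] at h1
  omega

lemma chi_one (q : ℕ) [Fact q.Prime] [Algebra (ZMod q) K] (hc : Fintype.card K = q ^ 2)
    (h3 : q % 4 = 3) (t : K) (ht : t ≠ 0) (a : ZMod q)
    (h : t ^ 2 = algebraMap (ZMod q) K a) : quadraticChar K t = 1 := by
  haveI : CharP K q := charP_of_injective_algebraMap (algebraMap (ZMod q) K).injective q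
  have hch : ringChar K ≠ 2 := by
    rw [ringChar.eq K q]; omega
  rw [quadraticChar_one_iff_isSquare ht, FiniteField.isSquare_iff hch ht, hc]
  have ha : a ≠ 0 := by rintro rfl; simp at h; exact ht h
  obtain ⟨m, hm⟩ : ∃ m, q = 4 * m + 3 := ⟨q / 4, by omega⟩
  have : q ^ 2 / 2 = 2 * ((q - 1) * (m + 1)) := by
    have hm' : q - 1 = 4 * m + 2 := by omega
    have : q ^ 2 = 2 * (2 * ((q - 1) * (m + 1))) + 1 := by rw [hm', hm]; ring
    omega
  rw [this, pow_mul, h, pow_mul, ← map_pow, ZMod.pow_card_sub_one_eq_one ha]; simp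

lemma chi_base (q : ℕ) [Fact q.Prime] [Algebra (ZMod q) K] (hc : Fintype.card K = q ^ 2)
    (h3 : q % 4 = 3) (a : ZMod q) (ha : a ≠ 0) :
    quadraticChar K (algebraMap (ZMod q) K a) = 1 :=
  chi_one q hc h3 _ (by simpa using ha) (a ^ 2) (by simp)

lemma AA_in (q : ℕ) [Fact q.Prime] [Algebra (ZMod q) K] (hc : Fintype.card K = q ^ 2)
    (h3 : q % 4 = 3) (w : ZMod q) :
    ∑ a : ZMod q, quadraticChar K (algebraMap (ZMod q) K w - algebraMap (ZMod q) K a) = q - 1 := by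
  have : ∀ a : ZMod q, quadraticChar K (algebraMap (ZMod q) K w - algebraMap (ZMod q) K a)
      = 1 - if a = w then 1 else 0 := by
    intro a
    split_ifs with h
    · simp [h]
    · rw [← map_sub, chi_base q hc h3 _ (sub_ne_zero.mpr (Ne.symm h))]; simp
  simp [this]

lemma sum_base (q : ℕ) [Fact q.Prime] [Algebra (ZMod q) K] (hc : Fintype.card K = q ^ 2)
    (h3 : q % 4 = 3) : 
    ∑ a : ZMod q, quadraticChar K (algebraMap (ZMod q) K a) = q - 1 := by
  have : ∀ a : ZMod q, quadraticChar K (algebraMap (ZMod q) K a)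
      = 1 - if a = 0 then 1 else 0 := by
    intro a
    split_ifs with h
    · simp [h]
    · rw [chi_base q hc h3 _ h]; simp
  simp [this]

lemma AA_out (q : ℕ) [Fact q.Prime] [Algebra (ZMod q) K] (hc : Fintype.card K = q ^ 2)
    (h3 : q % 4 = 3) (w : K) (hw : ∀ a : ZMod q, algebraMap (ZMod q) K a ≠ w) :
    ∑ a : ZMod q, quadraticChar K (w - algebraMap (ZMod q) K a) = - 1 := by
  haveI : CharP K q := charP_of_injective_algebraMap (algebraMap (ZMod q) K).injective q
  have hch : ringChar K ≠ 2 := by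
    rw [ringChar.eq K q]; omega
  let f : ZMod q × ZMod q → K := fun p =>
    algebraMap (ZMod q) K p.1 * w - algebraMap (ZMod q) K p.2
  have hinj : Function.Injective f := by
    rintro ⟨a, b⟩ ⟨c, e⟩ h
    simp only [f] at h
    have h' : algebraMap (ZMod q) K (a - c) * w = algebraMap (ZMod q) K (b - e) := by
      simp only [map_sub]; linear_combination h
    by_cases hac : a - c = 0
    · rw [hac, map_zero, zero_mul] at h'
      have : b - e = 0 := by
        apply (algebraMap (ZMod q) K).injective; rw [map_zero, ← h']
      rw [sub_eq_zero.mp hac, sub_eq_zero.mp this]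
    · exfalso
      have hne : algebraMap (ZMod q) K (a - c) ≠ 0 :=
        (map_ne_zero _).mpr hac
      apply hw ((b - e) / (a - c))
      rw [map_div₀, ← h']; field_simp
  have hbij : Function.Bijective f := by
    rw [Fintype.bijective_iff_injective_and_card]
    refine ⟨hinj, ?_⟩
    rw [Fintype.card_prod, ZMod.card, hc, sq]
  have h0 := quadraticChar_sum_zero hch
  rw [← Equiv.sum_comp (Equiv.ofBijective f hbij), Fintype.sum_prod_type] at h0
  simp only [Equiv.ofBijective_apply, f] at h0
  set A := ∑ a : ZMod q, quadraticChar K (w - algebraMap (ZMod q) K a) with hA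
  have hrow : ∀ b : ZMod q, ∑ a : ZMod q, quadraticChar K (algebraMap (ZMod q) K b * w
      - algebraMap (ZMod q) K a) = A + if b = 0 then (q - 1 - A) else 0 := by
    intro b
    split_ifs with hb
    · subst hb
      have := AA_in (K := K) q hc h3 0
      simp only [map_zero, zero_mul] at this ⊢
      rw [this]; ring
    · rw [← Equiv.sum_comp (Equiv.mulLeft₀ b hb), add_zero, hA]
      refine Finset.sum_congr rfl fun x _ => ?_
      have h : (Equiv.mulLeft₀ b hb) x = b * x := rfl
      rw [h, map_mul, ← mul_sub, map_mul, chi_base q hc h3 b hb, one_mul]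
  simp only [hrow, Finset.sum_add_distrib, Finset.sum_const, Finset.card_univ, ZMod.card,
    Finset.sum_ite_eq', Finset.mem_univ, if_true, nsmul_eq_mul] at h0
  have hq2 : (q : ℤ) - 1 ≠ 0 := by omega
  apply mul_left_cancel₀ hq2
  linarith

lemma SS_one (q : ℕ) [Fact q.Prime] [Algebra (ZMod q) K] (hc : Fintype.card K = q ^ 2)
    (h3 : q % 4 = 3) : SS (1 : K) = 2 * q := by
  haveI : CharP K q := charP_of_injective_algebraMap (algebraMap (ZMod q) K).injective q
  have hch : ringChar K ≠ 2 := by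
    rw [ringChar.eq K q]; omega
  have h0 := quadraticChar_sum_zero hch
  -- sum over all a of SS a
  have hS : ∀ a : ZMod q, SS (algebraMap (ZMod q) K a) =
      SS (1 : K) + if a = 0 then - SS (1 : K) else 0 := by
    intro a
    split_ifs with ha
    · subst ha
      rw [map_zero, add_neg_cancel]
      unfold SS
      rw [← h0]
      refine Finset.sum_congr rfl fun x _ => ?_
      rw [zero_mul, sub_zero]
      rcases eq_or_ne x 0 with rfl | hx
      · simp
      · rw [pow_succ, map_mul, quadraticChar_sq_one' hx, one_mul]
    · have hsq := chi_base (K := K) q hc h3 a ha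
      have ha' : algebraMap (ZMod q) K a ≠ 0 := by simpa using ha
      rw [quadraticChar_one_iff_isSquare ha'] at hsq
      obtain ⟨t, ht⟩ := hsq
      have ht0 : t ≠ 0 := by rintro rfl; simp at ht; exact ha ht
      rw [ht, add_zero, ← one_mul (t * t), ← sq, SS_mul_sq _ _ ht0,
        chi_one q hc h3 t ht0 a (by rw [ht, sq]), one_mul]
  have e1 : ∑ a : ZMod q, SS (algebraMap (ZMod q) K a) = (q - 1) * SS (1 : K) := by
    simp only [hS, Finset.sum_add_distrib, Finset.sum_const, Finset.card_univ, ZMod.card,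
      Finset.sum_ite_eq', Finset.mem_univ, if_true, nsmul_eq_mul]
    ring
  have e2 : ∑ a : ZMod q, SS (algebraMap (ZMod q) K a) = q * (2 * (q - 1)) := by
    unfold SS
    rw [Finset.sum_comm]
    have hx : ∀ x : K, ∑ a : ZMod q, quadraticChar K (x ^ 3 - algebraMap (ZMod q) K a * x)
        = - quadraticChar K x + q * ∑ a : ZMod q, if x ^ 2 = algebraMap (ZMod q) K a then
            quadraticChar K (algebraMap (ZMod q) K a) else 0 := by
      intro x
      have : ∀ a : ZMod q, quadraticChar K (x ^ 3 - algebraMap (ZMod q) K a * x) =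
          quadraticChar K x * quadraticChar K (x ^ 2 - algebraMap (ZMod q) K a) := by
        intro a; rw [← map_mul]; congr 1; ring
      simp only [this, ← Finset.mul_sum]
      by_cases hw : ∃ b : ZMod q, algebraMap (ZMod q) K b = x ^ 2
      · obtain ⟨b, hb⟩ := hw
        rw [← hb, AA_in q hc h3]
        simp only [(algebraMap (ZMod q) K).injective.eq_iff, Finset.sum_ite_eq,
          Finset.mem_univ, if_true]
        rcases eq_or_ne x 0 with rfl | hx
        · simp at hb; simp [hb]
        · have hb0 : b ≠ 0 := by rintro rfl; simp [eq_comm (a := (0 : K))] at hb; exact hx hb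
          rw [chi_one q hc h3 x hx b hb.symm, chi_base q hc h3 b hb0]; ring
      · push Not at hw
        rw [AA_out q hc h3 _ hw, Finset.sum_eq_zero]
        · ring
        · intro a _
          rw [if_neg (Ne.symm (hw a))]
    simp only [hx, Finset.sum_add_distrib, Finset.sum_neg_distrib, h0, ← Finset.mul_sum]
    rw [Finset.sum_comm, neg_zero, zero_add]
    congr 1
    have hr : ∀ a : ZMod q, (∑ x : K, if x ^ 2 = algebraMap (ZMod q) K a then
            quadraticChar K (algebraMap (ZMod q) K a) else 0) =
            2 * quadraticChar K (algebraMap (ZMod q) K a) := by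
      intro a
      rcases eq_or_ne a 0 with rfl | ha
      · simp
      · have := quadraticChar_card_sqrts hch (algebraMap (ZMod q) K a)
        rw [chi_base q hc h3 a ha] at this ⊢
        rw [Finset.sum_boole, mul_one]
        rw [Set.toFinset_ofPred] at this
        exact_mod_cast this
    simp only [hr, ← Finset.mul_sum, sum_base q hc h3]
  have hq2 : (q : ℤ) - 1 ≠ 0 := by omega
  apply mul_left_cancel₀ hq2
  linarith

/-- points of the curve as a sigma type plus infinity -/
lemma card_point (hch : ringChar K ≠ 2) (d : K) (hd : d ≠ 0) :
    (Nat.card (WeierstrassCurve.Affine.Point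
      (WeierstrassCurve.toAffine (⟨0, 0, 0, -d, 0⟩ : WeierstrassCurve K))) : ℤ) =
      Fintype.card K + 1 + SS d := by
  have h2 : (2 : K) ≠ 0 := Ring.two_ne_zero hch
  have hns : ∀ x y : K, (WeierstrassCurve.toAffine (⟨0, 0, 0, -d, 0⟩ : WeierstrassCurve K)).Nonsingular x y ↔ y ^ 2 = x ^ 3 - d * x := by
    intro x y
    rw [WeierstrassCurve.Affine.nonsingular_iff, WeierstrassCurve.Affine.equation_iff]
    simp only [zero_mul, add_zero, mul_zero, zero_add, sub_zero]
    constructor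
    · rintro ⟨h, -⟩; rw [h]; ring
    · intro h
      refine ⟨by rw [h]; ring, ?_⟩
      by_contra hcon
      push Not at hcon
      obtain ⟨ha, hb⟩ := hcon
      have hy : y = 0 := by
        have : 2 * y = 0 := by linear_combination hb
        simpa [h2] using this
      subst hy
      have hx : x * (x ^ 2 - d) = 0 := by linear_combination -h
      rcases mul_eq_zero.mp hx with h0 | h0
      · subst h0; apply hd; linear_combination ha
      · have : 2 * d = 0 := by linear_combination -ha - 3 * h0
        simp [h2, hd] at this
  let e : (WeierstrassCurve.Affine.Point
      (WeierstrassCurve.toAffine (⟨0, 0, 0, -d, 0⟩ : WeierstrassCurve K))) ≃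
      Option (Σ x : K, {y : K // y ^ 2 = x ^ 3 - d * x}) :=
    { toFun := fun P => match P with
        | .zero => none
        | .some x y h => some ⟨x, y, (hns x y).mp h⟩
      invFun := fun P => match P with
        | none => .zero
        | some ⟨x, y, h⟩ => .some x y ((hns x y).mpr h)
      left_inv := by rintro (_ | _) <;> rfl
      right_inv := by rintro (_ | ⟨x, y, h⟩) <;> rfl }
  rw [Nat.card_congr e, Nat.card_eq_fintype_card, Fintype.card_option, Fintype.card_sigma]
  have : ∀ x : K, ((Fintype.card {y : K // y ^ 2 = x ^ 3 - d * x} : ℕ) : ℤ) =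
      quadraticChar K (x ^ 3 - d * x) + 1 := by
    intro x
    rw [← quadraticChar_card_sqrts hch, Set.toFinset_ofPred, Fintype.card_subtype]
  push_cast
  simp only [this, Finset.sum_add_distrib, SS]
  simp
  ring

lemma main_count (q : ℕ) (hq : q.Prime) (h3 : q % 4 = 3) (hc : Fintype.card K = q ^ 2)
    (hchar : CharP K q) (d : K) (hd : d ≠ 0) :
    let N : ℤ := Nat.card (WeierstrassCurve.Affine.Point
        (WeierstrassCurve.toAffine (⟨0, 0, 0, -d, 0⟩ : WeierstrassCurve K)))
    (¬ (∃ y : K, y ^ 2 = d) → N = q ^ 2 + 1) ∧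
    ((∃ y : K, y ^ 2 = d) ∧ ¬ (∃ y : K, y ^ 4 = d) → N = q ^ 2 + 1 - 2 * q) ∧
    ((∃ y : K, y ^ 4 = d) → N = q ^ 2 + 1 + 2 * q) := by
  intro N
  haveI : Fact q.Prime := ⟨hq⟩
  letI : Algebra (ZMod q) K := ZMod.algebra K q
  have hch : ringChar K ≠ 2 := by
    rw [ringChar.eq K q]; omega
  have hN : N = q ^ 2 + 1 + SS d := by
    have := card_point hch d hd
    rw [hc] at this
    exact_mod_cast this
  have h1 := SS_one (K := K) q hc h3
  refine ⟨fun h => ?_, fun ⟨⟨y, hy⟩, h⟩ => ?_, fun ⟨y, hy⟩ => ?_⟩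
  · rw [hN, SS_nonsq q h3 d, add_zero]
    rintro ⟨y, hy⟩
    exact h ⟨y, by rw [hy, sq]⟩
  · have hy0 : y ≠ 0 := by rintro rfl; simp at hy; exact hd hy.symm
    have : quadraticChar K y = -1 := by
      rw [quadraticChar_neg_one_iff_not_isSquare]
      rintro ⟨z, rfl⟩
      exact h ⟨z, by rw [← hy]; ring⟩
    rw [hN, ← hy, ← one_mul (y ^ 2), SS_mul_sq _ _ hy0, this, h1]; ring
  · have hy0 : y ≠ 0 := by rintro rfl; simp at hy; exact hd hy.symm
    rw [hN, ← hy, show y ^ 4 = 1 * (y ^ 2) ^ 2 by ring, SS_mul_sq _ _ (pow_ne_zero 2 hy0),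
      quadraticChar_sq_one' hy0, h1]; ring

end helper

/-- reduction of coordinates mod q -/
def redMap (q : ℕ) : GaussianInt →+ ZMod q × ZMod q where
  toFun z := (z.re, z.im)
  map_zero' := by simp
  map_add' := by intro x y; simp

lemma card_quot_s15 (q : ℕ) :
    Nat.card (GaussianInt ⧸ Ideal.span {((q : ℕ) : GaussianInt)}) = q ^ 2 := by
  have hs : Function.Surjective (redMap q) := by
    rintro ⟨a, b⟩
    obtain ⟨m, rfl⟩ := ZMod.intCast_surjective a
    obtain ⟨n, rfl⟩ := ZMod.intCast_surjective b
    exact ⟨⟨m, n⟩, rfl⟩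
  have hk : (redMap q).ker = (Ideal.span {((q : ℕ) : GaussianInt)}).toAddSubgroup := by
    ext z
    rw [AddMonoidHom.mem_ker, Submodule.mem_toAddSubgroup, Ideal.mem_span_singleton]
    have : ((q : ℕ) : GaussianInt) = ((q : ℤ) : GaussianInt) := by simp
    rw [this, Zsqrtd.intCast_dvd, ← ZMod.intCast_zmod_eq_zero_iff_dvd, ← ZMod.intCast_zmod_eq_zero_iff_dvd]
    simp [redMap, Prod.ext_iff]
  have e := QuotientAddGroup.quotientKerEquivOfSurjective (redMap q) hs
  have := Nat.card_congr ((QuotientAddGroup.quotientAddEquivOfEq hk).symm.trans e).toEquiv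
  rw [Nat.card_prod, Nat.card_zmod, ← sq] at this
  exact this

/-- Point count of the reduction of `E_d : y² = x³ - dx` at an inert prime
`q ≡ 3 (mod 4)`, over the residue field `k = ℤ[i]/(q)` of size `q²`. -/
theorem point_count_degree_two (q : ℕ) (hq : q.Prime) (h3 : q % 4 = 3)
    (d : ℤ[i]) (hd : ∀ x : ℤ[i], x ^ 4 ∣ d → IsUnit x)
    (hcop : IsCoprime d ((q : ℕ) : ℤ[i])) :
    let k := ℤ[i] ⧸ Ideal.span {((q : ℕ) : ℤ[i])}
    let δ : k := Ideal.Quotient.mk _ d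
    let N : ℤ := Nat.card (WeierstrassCurve.Affine.Point
        (WeierstrassCurve.toAffine ⟨0, 0, 0, -δ, 0⟩))
    (¬ (∃ y : k, y ^ 2 = δ) → N = q ^ 2 + 1) ∧
    ((∃ y : k, y ^ 2 = δ) ∧ ¬ (∃ y : k, y ^ 4 = δ) → N = q ^ 2 + 1 - 2 * q) ∧
    ((∃ y : k, y ^ 4 = δ) → N = q ^ 2 + 1 + 2 * q) := by
  intro k δ
  haveI : Fact q.Prime := ⟨hq⟩
  have hp : Prime ((q : ℕ) : ℤ[i]) := GaussianInt.prime_of_nat_prime_of_mod_four_eq_three q h3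
  haveI hmax : (Ideal.span {((q : ℕ) : ℤ[i])}).IsMaximal :=
    PrincipalIdealRing.isMaximal_of_irreducible hp.irreducible
  have hcard : Nat.card k = q ^ 2 := card_quot_s15 q
  haveI : Finite k := Nat.finite_of_card_ne_zero (by rw [hcard]; exact pow_ne_zero 2 hq.ne_zero)
  letI : Fintype k := Fintype.ofFinite k
  letI : DecidableEq k := Classical.decEq k
  letI : Field k := Ideal.Quotient.field _
  have hchar : CharP k q := by
    have h0 : ((q : ℕ) : k) = 0 := by
      have : Ideal.Quotient.mk (Ideal.span {((q : ℕ) : ℤ[i])}) ((q : ℕ) : ℤ[i]) = 0 :=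
        Ideal.Quotient.eq_zero_iff_mem.mpr (Ideal.mem_span_singleton_self _)
      rw [map_natCast] at this
      exact this
    exact (CharP.charP_iff_prime_eq_zero hq).mpr h0
  have hδ : δ ≠ 0 := by
    intro h
    have := Ideal.Quotient.eq_zero_iff_mem.mp h
    rw [Ideal.mem_span_singleton] at this
    exact hp.not_isUnit (hcop.isUnit_of_dvd' this dvd_rfl)
  exact main_count (K := k) q hq h3 (by rw [← Nat.card_eq_fintype_card]; exact hcard) hchar δ hδ
end
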